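/- arXiv:2402.04148 — 3 statements merged into one kernel-verified Lean document; each statement's English description precedes it below -/
import Mathlib

section
/- Let n ≥ 1 and let v, w ∈ B_n. Then v ≤ w in the Bruhat order of B_n if and only if v ≤ w in the Bruhat order of the symmetric group of all permutations of {−n,…,−1,1,…,n}. -/
open scoped BigOperators

/-- Membership in the hyperoctahedral group `B_n`, viewed as permutations `w` of `ℤ`
satisfying `w (-i) = - w i` and fixing everything outside `{-n, …, -1, 1, …, n}`. -/
def IsBn (n : ℕ) (w : Equiv.Perm ℤ) : Prop :=
  (∀ i : ℤ, w (-i) = - w i) ∧ ∀ i : ℤ, (n : ℤ) < |i| → w i = i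

/-- The window of `w` avoids the signed pattern `1 2̄`. -/
def Avoids12bar (n : ℕ) (w : Equiv.Perm ℤ) : Prop :=
  ¬ ∃ i j : ℤ, 1 ≤ i ∧ i < j ∧ j ≤ (n : ℤ) ∧ 0 < w i ∧ w j < 0 ∧ w i < -(w j)

/-- The window of `w` avoids the signed pattern `2̄ 1`. -/
def Avoids2bar1 (n : ℕ) (w : Equiv.Perm ℤ) : Prop :=
  ¬ ∃ i j : ℤ, 1 ≤ i ∧ i < j ∧ j ≤ (n : ℤ) ∧ w i < 0 ∧ 0 < w j ∧ w j < -(w i)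

/-- The window of `w` avoids the signed pattern `2̄ 1̄`. -/
def Avoids2bar1bar (n : ℕ) (w : Equiv.Perm ℤ) : Prop :=
  ¬ ∃ i j : ℤ, 1 ≤ i ∧ i < j ∧ j ≤ (n : ℤ) ∧ w i < w j ∧ w j < 0

/-- The window of `w` avoids the signed pattern `3 1 2`. -/
def Avoids312s (n : ℕ) (w : Equiv.Perm ℤ) : Prop :=
  ¬ ∃ i j k : ℤ, 1 ≤ i ∧ i < j ∧ j < k ∧ k ≤ (n : ℤ) ∧ 0 < w j ∧ w j < w k ∧ w k < w i

/-- The window of `w` avoids the signed pattern `3 1̄ 2`. -/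
def Avoids31bar2 (n : ℕ) (w : Equiv.Perm ℤ) : Prop :=
  ¬ ∃ i j k : ℤ, 1 ≤ i ∧ i < j ∧ j < k ∧ k ≤ (n : ℤ) ∧
    w j < 0 ∧ 0 < w k ∧ w k < w i ∧ -(w j) < w k

/-- The window of `w` avoids the five signed patterns `1 2̄`, `2̄ 1`, `2̄ 1̄`, `3 1 2`, `3 1̄ 2`. -/
def AvoidsFive (n : ℕ) (w : Equiv.Perm ℤ) : Prop :=
  Avoids12bar n w ∧ Avoids2bar1 n w ∧ Avoids2bar1bar n w ∧ Avoids312s n w ∧ Avoids31bar2 n w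

/-- The long one-line notation `(w(-n), …, w(-1), w(1), …, w(n))` avoids the pattern `3412`. -/
def LongAvoids3412 (n : ℕ) (w : Equiv.Perm ℤ) : Prop :=
  ¬ ∃ i1 i2 i3 i4 : ℤ, -(n : ℤ) ≤ i1 ∧ i1 < i2 ∧ i2 < i3 ∧ i3 < i4 ∧ i4 ≤ (n : ℤ) ∧
    i1 ≠ 0 ∧ i2 ≠ 0 ∧ i3 ≠ 0 ∧ i4 ≠ 0 ∧
    w i3 < w i4 ∧ w i4 < w i1 ∧ w i1 < w i2

/-- The long one-line notation `(w(-n), …, w(-1), w(1), …, w(n))` avoids the pattern `4231`. -/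
def LongAvoids4231 (n : ℕ) (w : Equiv.Perm ℤ) : Prop :=
  ¬ ∃ i1 i2 i3 i4 : ℤ, -(n : ℤ) ≤ i1 ∧ i1 < i2 ∧ i2 < i3 ∧ i3 < i4 ∧ i4 ≤ (n : ℤ) ∧
    i1 ≠ 0 ∧ i2 ≠ 0 ∧ i3 ≠ 0 ∧ i4 ≠ 0 ∧
    w i4 < w i2 ∧ w i2 < w i3 ∧ w i3 < w i1

/-- The Coxeter generators of `B_n` inside `Equiv.Perm ℤ`: the element `t` interchanging
`1` and `-1`, and the elements `s_i = (i, i+1)(-i, -(i+1))` for `1 ≤ i ≤ n - 1`. -/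
def bGen (n : ℕ) : Set (Equiv.Perm ℤ) :=
  {x | x = Equiv.swap 1 (-1) ∨
    ∃ i : ℤ, 1 ≤ i ∧ i ≤ (n : ℤ) - 1 ∧ x = Equiv.swap i (i + 1) * Equiv.swap (-i) (-(i + 1))}

/-- The `2n - 1` adjacent transpositions of the symmetric group on
`{-n, …, -1, 1, …, n}` (with the linear order `-n < ⋯ < -1 < 1 < ⋯ < n`). -/
def sGen (n : ℕ) : Set (Equiv.Perm ℤ) :=
  {x | ∃ i : ℤ, -(n : ℤ) ≤ i ∧ i ≤ (n : ℤ) - 1 ∧ i ≠ 0 ∧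
    x = Equiv.swap i (if i = -1 then 1 else i + 1)}

/-- `l` is a reduced word for `w` with respect to the generating set `S`:
its letters lie in `S`, its product is `w`, and it has minimal length among such words. -/
def IsReducedWord (S : Set (Equiv.Perm ℤ)) (l : List (Equiv.Perm ℤ)) (w : Equiv.Perm ℤ) :
    Prop :=
  (∀ x ∈ l, x ∈ S) ∧ l.prod = w ∧
    ∀ l' : List (Equiv.Perm ℤ), (∀ x ∈ l', x ∈ S) → l'.prod = w → l.length ≤ l'.length

/-- Bruhat order with respect to the generating set `S`: `v ≤ w` iff some reduced word
for `w` contains a reduced word for `v` as a (not-necessarily-contiguous) subsequence. -/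
def BruhatLe (S : Set (Equiv.Perm ℤ)) (v w : Equiv.Perm ℤ) : Prop :=
  ∃ lw lv : List (Equiv.Perm ℤ), IsReducedWord S lw w ∧ IsReducedWord S lv v ∧ lv.Sublist lw

namespace BruhatAux

open Equiv

/-- The underlying set. -/
noncomputable def D (n : ℕ) : Finset ℤ := (Finset.Icc (-(n : ℤ)) n).erase 0

lemma mem_D {n : ℕ} {i : ℤ} : i ∈ D n ↔ i ≠ 0 ∧ -(n : ℤ) ≤ i ∧ i ≤ n := by
  simp [D]

/-- Adjacent elements. -/
def Adj (n : ℕ) (a b : ℤ) : Prop := a ∈ D n ∧ b ∈ D n ∧ a < b ∧ ∀ k ∈ D n, k ≤ a ∨ b ≤ k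

/-- Rank function. -/
noncomputable def rk (n : ℕ) (w : Perm ℤ) (i j : ℤ) : ℕ := ((D n).filter (fun k => k ≤ i ∧ j ≤ w k)).card

/-- Rank order. -/
def R (n : ℕ) (v w : Perm ℤ) : Prop := ∀ i j, rk n v i j ≤ rk n w i j

/-- Inversion number. -/
noncomputable def inv (n : ℕ) (w : Perm ℤ) : ℕ :=
  ((D n ×ˢ D n).filter (fun p => p.1 < p.2 ∧ w p.2 < w p.1)).card

lemma swap_mem {n : ℕ} {a b : ℤ} (h : Adj n a b) (k : ℤ) : swap a b k ∈ D n ↔ k ∈ D n := by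
  obtain ⟨ha, hb, -, -⟩ := h
  rw [swap_apply_def]
  split_ifs with h1 h2
  · subst h1; tauto
  · subst h2; tauto
  · rfl

lemma inv_up {n : ℕ} {a b : ℤ} (h : Adj n a b) (w : Perm ℤ) (hw : w a < w b) :
    inv n (w * swap a b) = inv n w + 1 := by
  have key : (D n ×ˢ D n).filter (fun p => p.1 < p.2 ∧ (w * swap a b) p.2 < (w * swap a b) p.1)
      = insert (a, b) (((D n ×ˢ D n).filter (fun p => p.1 < p.2 ∧ w p.2 < w p.1)).map
          (Equiv.prodCongr (swap a b) (swap a b)).toEmbedding) := by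
    ext ⟨i, j⟩
    rw [Finset.mem_insert, Finset.mem_map_equiv]
    simp only [Finset.mem_filter, Finset.mem_product]
    simp only [Perm.mul_apply, Equiv.prodCongr_symm,
      Equiv.prodCongr_apply, Prod.map, Equiv.symm_swap, swap_mem h, Prod.mk.injEq]
    obtain ⟨ha, hb, hab, hn⟩ := h
    by_cases hi : i ∈ D n
    swap
    · have : i ≠ a := by rintro rfl; exact hi ha
      simp [hi, this]
    by_cases hj : j ∈ D n
    swap
    · have : j ≠ b := by rintro rfl; exact hj hb
      simp [hj, this]
    have h1 := hn i hi
    have h2 := hn j hj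
    by_cases e1 : i = a
    · subst e1
      by_cases e2 : j = b
      · subst e2
        simp [ha, hb, hab, hw]
      · by_cases e3 : j = i
        · subst e3; simp [e2]
        · rw [swap_apply_left, swap_apply_of_ne_of_ne e3 e2]
          simp only [hi, hj, e2, and_false, false_or, true_and]
          constructor <;> rintro ⟨x, y⟩ <;> refine ⟨?_, y⟩ <;> omega
    · by_cases e1' : i = b
      · subst e1'
        by_cases e2 : j = i
        · subst e2; simp [e1]
        · by_cases e3 : j = a
          · subst e3
            simp only [swap_apply_left, swap_apply_right]
            constructor
            · rintro ⟨-, x, -⟩; omega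
            · rintro (⟨x, -⟩ | ⟨-, -, x⟩)
              · exact absurd x e1
              · omega
          · rw [swap_apply_right, swap_apply_of_ne_of_ne e3 e2]
            simp only [hi, hj, e2, and_false, false_or, true_and]
            constructor <;> rintro ⟨x, y⟩ <;> refine ⟨?_, y⟩ <;> omega
      · rw [swap_apply_of_ne_of_ne e1 e1']
        simp only [e1, false_and, false_or]
        by_cases e2 : j = a
        · subst e2
          simp only [swap_apply_left, hi, hj, true_and]
          constructor <;> rintro ⟨x, y⟩ <;> refine ⟨?_, y⟩ <;> omega
        · by_cases e3 : j = b
          · subst e3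
            simp only [swap_apply_right, hi, hj, true_and]
            constructor <;> rintro ⟨x, y⟩ <;> refine ⟨?_, y⟩ <;> omega
          · rw [swap_apply_of_ne_of_ne e2 e3]
  unfold inv
  rw [key, Finset.card_insert_of_notMem, Finset.card_map]
  rw [Finset.mem_map_equiv]
  simp only [Finset.mem_filter, Equiv.prodCongr_symm,
      Equiv.prodCongr_apply, Prod.map, Equiv.symm_swap, swap_apply_left, swap_apply_right]
  rintro ⟨-, x, -⟩
  have := h.2.2.1
  omega

lemma mul_swap_cancel (w : Perm ℤ) (a b : ℤ) : w * swap a b * swap a b = w := by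
  rw [mul_assoc, swap_mul_self, mul_one]

lemma inv_down {n : ℕ} {a b : ℤ} (h : Adj n a b) (w : Perm ℤ) (hw : w b < w a) :
    inv n w = inv n (w * swap a b) + 1 := by
  have := inv_up h (w * swap a b) (by simpa using hw)
  rwa [mul_swap_cancel] at this

lemma rk_mid {n : ℕ} {a b : ℤ} (h : Adj n a b) (w : Perm ℤ) (i j : ℤ) (h1 : a ≤ i) (h2 : i < b) :
    rk n w i j = rk n w (a - 1) j + if j ≤ w a then 1 else 0 := by
  obtain ⟨ha, hb, hab, hn⟩ := h
  unfold rk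
  by_cases hj : j ≤ w a
  · rw [if_pos hj, ← Finset.card_insert_of_notMem (a := a)]
    · congr 1
      ext k
      simp only [Finset.mem_insert, Finset.mem_filter]
      constructor
      · rintro ⟨x, y, z⟩
        have := hn k x
        by_cases e : k = a
        · exact Or.inl e
        · right; refine ⟨x, ?_, z⟩; omega
      · rintro (rfl | ⟨x, y, z⟩)
        · exact ⟨ha, h1, hj⟩
        · refine ⟨x, ?_, z⟩; omega
    · simp
  · rw [if_neg hj, add_zero]
    congr 1
    ext k
    simp only [Finset.mem_filter]
    constructor
    · rintro ⟨x, y, z⟩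
      have := hn k x
      have : k ≠ a := by rintro rfl; exact hj z
      refine ⟨x, ?_, z⟩; omega
    · rintro ⟨x, y, z⟩
      refine ⟨x, ?_, z⟩; omega

lemma rk_top {n : ℕ} {a b : ℤ} (h : Adj n a b) (w : Perm ℤ) (j : ℤ) :
    rk n w b j = rk n w (a - 1) j + (if j ≤ w a then 1 else 0) + if j ≤ w b then 1 else 0 := by
  have hab := h.2.2.1
  rw [← rk_mid h w (b - 1) j (by omega) (by omega)]
  obtain ⟨ha, hb, hab, hn⟩ := h
  unfold rk
  by_cases hj : j ≤ w b
  · rw [if_pos hj, ← Finset.card_insert_of_notMem (a := b)]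
    · congr 1
      ext k
      simp only [Finset.mem_insert, Finset.mem_filter]
      constructor
      · rintro ⟨x, y, z⟩
        by_cases e : k = b
        · exact Or.inl e
        · right; refine ⟨x, ?_, z⟩; omega
      · rintro (rfl | ⟨x, y, z⟩)
        · exact ⟨hb, le_refl _, hj⟩
        · refine ⟨x, ?_, z⟩; omega
    · simp
  · rw [if_neg hj, add_zero]
    congr 1
    ext k
    simp only [Finset.mem_filter]
    constructor
    · rintro ⟨x, y, z⟩
      have : k ≠ b := by rintro rfl; exact hj z
      refine ⟨x, ?_, z⟩; omega
    · rintro ⟨x, y, z⟩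
      refine ⟨x, ?_, z⟩; omega

lemma rk_out {n : ℕ} {a b : ℤ} (h : Adj n a b) (w : Perm ℤ) (i j : ℤ) (h1 : i < a ∨ b ≤ i) :
    rk n (w * swap a b) i j = rk n w i j := by
  unfold rk
  rw [← Finset.card_map (swap a b).toEmbedding]
  congr 1
  ext k
  rw [Finset.mem_map_equiv, symm_swap]
  simp only [Finset.mem_filter]
  simp only [swap_mem h, Perm.mul_apply, swap_apply_self]
  have hab := h.2.2.1
  have : swap a b k ≤ i ↔ k ≤ i := by
    rw [swap_apply_def]; split_ifs <;> omega
  rw [this]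

lemma rk_swap_mid {n : ℕ} {a b : ℤ} (h : Adj n a b) (w : Perm ℤ) (i j : ℤ) (h1 : a ≤ i)
    (h2 : i < b) :
    rk n (w * swap a b) i j = rk n w (a - 1) j + if j ≤ w b then 1 else 0 := by
  rw [rk_mid h _ i j h1 h2, rk_out h _ _ _ (by omega)]
  simp

lemma R_refl (n : ℕ) (w : Perm ℤ) : R n w w := fun _ _ => le_refl _

lemma R_trans {n : ℕ} {u v w : Perm ℤ} (h : R n u v) (h' : R n v w) : R n u w :=
  fun i j => (h i j).trans (h' i j)

lemma R_down {n : ℕ} {a b : ℤ} (h : Adj n a b) (w : Perm ℤ) (hw : w b < w a) :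
    R n (w * swap a b) w := by
  intro i j
  by_cases hi : i < a ∨ b ≤ i
  · rw [rk_out h _ _ _ hi]
  · rw [rk_swap_mid h _ _ _ (by omega) (by omega), rk_mid h w i j (by omega) (by omega)]
    split_ifs <;> omega

lemma lift_dd {n : ℕ} {a b : ℤ} (h : Adj n a b) (v w : Perm ℤ) (hv : v b < v a) (hw : w b < w a)
    (hR : R n v w) : R n (v * swap a b) (w * swap a b) := by
  intro i j
  by_cases hi : i < a ∨ b ≤ i
  · rw [rk_out h _ _ _ hi, rk_out h _ _ _ hi]; exact hR i j
  · rw [rk_swap_mid h _ _ _ (by omega) (by omega), rk_swap_mid h _ _ _ (by omega) (by omega)]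
    have h1 := hR (a - 1) j
    have h2 := hR b j
    rw [rk_top h, rk_top h] at h2
    split_ifs at * <;> omega

lemma lift_uu {n : ℕ} {a b : ℤ} (h : Adj n a b) (v w : Perm ℤ) (hw : w a < w b)
    (hR : R n v w) : R n (v * swap a b) (w * swap a b) := by
  intro i j
  by_cases hi : i < a ∨ b ≤ i
  · rw [rk_out h _ _ _ hi, rk_out h _ _ _ hi]; exact hR i j
  · rw [rk_swap_mid h _ _ _ (by omega) (by omega), rk_swap_mid h _ _ _ (by omega) (by omega)]
    have h1 := hR (a - 1) j
    have h2 := hR b j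
    rw [rk_top h, rk_top h] at h2
    split_ifs at * <;> omega

lemma lift_ud {n : ℕ} {a b : ℤ} (h : Adj n a b) (v w : Perm ℤ) (hv : v a < v b)
    (hR : R n v w) : R n v (w * swap a b) := by
  intro i j
  by_cases hi : i < a ∨ b ≤ i
  · rw [rk_out h _ _ _ hi]; exact hR i j
  · rw [rk_mid h v i j (by omega) (by omega), rk_swap_mid h _ _ _ (by omega) (by omega)]
    have h1 := hR (a - 1) j
    have h2 := hR b j
    rw [rk_top h, rk_top h] at h2
    split_ifs at * <;> omega

/-- Permutations supported on `D n`. -/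
def HA (n : ℕ) (w : Perm ℤ) : Prop := ∀ i, i ∉ D n → w i = i

lemma HA_mem {n : ℕ} {w : Perm ℤ} (h : HA n w) {i : ℤ} (hi : i ∈ D n) : w i ∈ D n := by
  by_contra hc
  have := w.injective (h _ hc)
  rw [this] at hc
  exact hc hi

lemma HA_sum {n : ℕ} {w : Perm ℤ} (h : HA n w) : ∑ k ∈ D n, w k = ∑ k ∈ D n, k := by
  apply Finset.sum_bijective w w.bijective
  · intro i
    constructor
    · exact HA_mem h
    · intro hi
      by_contra hc
      rw [h i hc] at hi
      exact hc hi
  · intros; rfl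

lemma HA_eq_one_of_le {n : ℕ} {w : Perm ℤ} (h : HA n w) (hle : ∀ k ∈ D n, w k ≤ k) : w = 1 := by
  have := (Finset.sum_eq_sum_iff_of_le hle).1 (HA_sum h)
  ext i
  by_cases hi : i ∈ D n
  · exact this i hi
  · exact h i hi

lemma HA_eq_one_of_ge {n : ℕ} {w : Perm ℤ} (h : HA n w) (hle : ∀ k ∈ D n, k ≤ w k) : w = 1 := by
  have := (Finset.sum_eq_sum_iff_of_le hle).1 (HA_sum h).symm
  ext i
  by_cases hi : i ∈ D n
  · exact (this i hi).symm
  · exact h i hi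

lemma R_one {n : ℕ} {v : Perm ℤ} (h : HA n v) (hR : R n v 1) : v = 1 := by
  apply HA_eq_one_of_le h
  intro k hk
  have h1 := hR k (k + 1)
  have h2 : rk n 1 k (k + 1) = 0 := by
    unfold rk
    rw [Finset.card_eq_zero, Finset.filter_eq_empty_iff]
    intro x _
    rw [Perm.one_apply]
    omega
  rw [h2, Nat.le_zero] at h1
  unfold rk at h1
  rw [Finset.card_eq_zero, Finset.filter_eq_empty_iff] at h1
  have := h1 hk
  omega

/-- Successor in `D n`. -/
def nxt (i : ℤ) : ℤ := if i = -1 then 1 else i + 1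

lemma adj_nxt {n : ℕ} {i : ℤ} (h1 : -(n : ℤ) ≤ i) (h2 : i ≤ (n : ℤ) - 1) (h3 : i ≠ 0) :
    Adj n i (nxt i) := by
  unfold Adj nxt
  simp only [mem_D]
  split_ifs <;> refine ⟨?_, ?_, ?_, ?_⟩ <;> try intro k
  all_goals omega

lemma no_desc {n : ℕ} {w : Perm ℤ} (h : HA n w)
    (hd : ∀ i : ℤ, -(n : ℤ) ≤ i → i ≤ (n : ℤ) - 1 → i ≠ 0 → w i < w (nxt i)) : w = 1 := by
  have mono : ∀ d : ℕ, ∀ a ∈ D n, ∀ b ∈ D n, a < b → b ≤ a + d → w a < w b := by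
    intro d
    induction d with
    | zero => intro a _ b _ h1 h2; simp at h2; omega
    | succ d ih =>
      intro a ha b hb hab hd'
      have ha' := mem_D.1 ha
      have hb' := mem_D.1 hb
      have hA := adj_nxt (n := n) (i := a) (by omega) (by omega) ha'.1
      have h1 := hd a (by omega) (by omega) ha'.1
      have h2 := hA.2.2.2 b hb
      by_cases e : b = nxt a
      · rwa [e]
      · have h3 := hA.2.2.1
        refine h1.trans (ih _ hA.2.1 b hb (by omega) ?_)
        push_cast at hd'
        omega
  have sm : StrictMono (fun x : D n => (⟨w x.1, HA_mem h x.2⟩ : D n)) := by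
    intro x y hxy
    have : (x : ℤ) < y := hxy
    exact mono (y - x : ℤ).toNat x x.2 y y.2 this (by omega)
  apply HA_eq_one_of_ge h
  intro k hk
  exact sm.le_apply (x := ⟨k, hk⟩)

/-- The abstract argument. -/
theorem main (S : Set (Perm ℤ)) (H : Perm ℤ → Prop) (L : Perm ℤ → ℕ) (c : ℕ) (hc : 0 < c)
    (R : Perm ℤ → Perm ℤ → Prop)
    (h1 : H 1) (hH : ∀ w s, H w → s ∈ S → H (w * s)) (hinv : ∀ s ∈ S, s * s = 1)
    (L1 : L 1 = 0)
    (hL : ∀ w s, H w → s ∈ S → L (w * s) = L w + c ∨ L w = L (w * s) + c)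
    (hdesc : ∀ w, H w → w ≠ 1 → ∃ s ∈ S, L w = L (w * s) + c)
    (Rrefl : ∀ w, R w w) (Rtrans : ∀ u v w, R u v → R v w → R u w)
    (Rdown : ∀ v s, H v → s ∈ S → L v = L (v * s) + c → R (v * s) v)
    (lift1 : ∀ v w s, H v → H w → s ∈ S → L v = L (v * s) + c → L w = L (w * s) + c →
      R v w → R (v * s) (w * s))
    (lift2 : ∀ v w s, H v → H w → s ∈ S → L (w * s) = L w + c →
      R v w → R (v * s) (w * s))
    (lift3 : ∀ v w s, H v → H w → s ∈ S → L (v * s) = L v + c → L w = L (w * s) + c →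
      R v w → R v (w * s))
    (R1 : ∀ v, H v → R v 1 → v = 1) (v w : Perm ℤ) (hv : H v) (hw : H w) :
    BruhatLe S v w ↔ R v w := by
  have hwd : ∀ l : List (Perm ℤ), (∀ x ∈ l, x ∈ S) → H l.prod ∧ L l.prod ≤ c * l.length := by
    intro l
    induction l using List.reverseRecOn with
    | nil => intro _; simp [h1, L1]
    | append_singleton l s ih =>
      intro hl
      have ⟨a, b⟩ := ih (fun x hx => hl x (by simp [hx]))
      have hs : s ∈ S := hl s (by simp)
      rw [List.prod_append, List.prod_singleton]
      refine ⟨hH _ _ a hs, ?_⟩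
      rw [List.length_append, List.length_singleton, mul_add, mul_one]
      have := hL _ _ a hs
      omega
  have hcan : ∀ s ∈ S, ∀ w, w * s * s = w := by
    intro s hs w; rw [mul_assoc, hinv s hs, mul_one]
  have hex : ∀ k : ℕ, ∀ w, H w → L w ≤ k → ∃ l : List (Perm ℤ), (∀ x ∈ l, x ∈ S) ∧ l.prod = w ∧
      c * l.length = L w := by
    intro k
    induction k with
    | zero =>
      intro w hw hk
      by_cases e : w = 1
      · exact ⟨[], by simp, by simp [e], by simp [e, L1]⟩
      · obtain ⟨s, hs, h⟩ := hdesc w hw e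
        omega
    | succ k ih =>
      intro w hw hk
      by_cases e : w = 1
      · exact ⟨[], by simp, by simp [e], by simp [e, L1]⟩
      · obtain ⟨s, hs, h⟩ := hdesc w hw e
        obtain ⟨l, a, b, d⟩ := ih (w * s) (hH _ _ hw hs) (by omega)
        refine ⟨l ++ [s], ?_, ?_, ?_⟩
        · intro x hx
          rw [List.mem_append, List.mem_singleton] at hx
          rcases hx with hx | rfl
          · exact a x hx
          · exact hs
        · rw [List.prod_append, List.prod_singleton, b, hcan s hs]
        · rw [List.length_append, List.length_singleton, mul_add, mul_one]
          omega
  have hred : ∀ l w, H w → (IsReducedWord S l w ↔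
      (∀ x ∈ l, x ∈ S) ∧ l.prod = w ∧ c * l.length = L w) := by
    intro l w hw
    constructor
    · rintro ⟨a, b, d⟩
      refine ⟨a, b, ?_⟩
      obtain ⟨l', a', b', d'⟩ := hex _ w hw le_rfl
      have e1 := d l' a' b'
      have e2 := (hwd l a).2
      rw [b] at e2
      have e3 := Nat.mul_le_mul_left c e1
      omega
    · rintro ⟨a, b, d⟩
      refine ⟨a, b, ?_⟩
      intro l' a' b'
      have e2 := (hwd l' a').2
      rw [b', ← d] at e2
      exact Nat.le_of_mul_le_mul_left e2 hc
  -- prefixes of reduced words are reduced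
  have hpre : ∀ l s, (∀ x ∈ l ++ [s], x ∈ S) → c * (l ++ [s]).length = L (l ++ [s]).prod →
      (∀ x ∈ l, x ∈ S) ∧ s ∈ S ∧ H l.prod ∧ c * l.length = L l.prod ∧
        (l ++ [s]).prod = l.prod * s ∧ L (l.prod * s) = L l.prod + c := by
    intro l s hl hlen
    have hl' : ∀ x ∈ l, x ∈ S := fun x hx => hl x (by simp [hx])
    have hs : s ∈ S := hl s (by simp)
    obtain ⟨a, b⟩ := hwd l hl'
    rw [List.prod_append, List.prod_singleton, List.length_append, List.length_singleton, mul_add,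
      mul_one] at hlen
    have := hL _ _ a hs
    refine ⟨hl', hs, a, ?_, by simp, ?_⟩ <;> omega
  have fwd : ∀ lw lv : List (Perm ℤ), (∀ x ∈ lw, x ∈ S) → (∀ x ∈ lv, x ∈ S) →
      c * lw.length = L lw.prod → c * lv.length = L lv.prod → lv.Sublist lw →
      R lv.prod lw.prod := by
    intro lw
    induction lw using List.reverseRecOn with
    | nil =>
      intro lv _ _ _ _ h
      rw [List.sublist_nil] at h
      subst h
      exact Rrefl _
    | append_singleton lw s ih =>
      intro lv hlw hlv ew ev hsub
      obtain ⟨hlw', hs, hHw, ew', pw, Lw⟩ := hpre lw s hlw ew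
      obtain ⟨l1, l2, rfl, hs1, hs2⟩ := List.sublist_append_iff.1 hsub
      have hc2 : l2 = [] ∨ l2 = [s] := by
        cases l2 with
        | nil => exact Or.inl rfl
        | cons x t =>
          right
          have h2 := hs2.length_le
          exact hs2.eq_of_length_le (by simp)
      rcases hc2 with rfl | rfl
      · rw [List.append_nil] at *
        have hR := ih l1 hlw' hlv ew' ev hs1
        have hHv := (hwd l1 hlv).1
        rw [pw]
        refine Rtrans _ _ _ hR ?_
        have := Rdown (lw.prod * s) s (hH _ _ hHw hs) hs (by rw [hcan s hs]; exact Lw)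
        rwa [hcan s hs] at this
      · obtain ⟨hl1, _, hHv, ev', pv, Lv⟩ := hpre l1 s hlv ev
        have hR := ih l1 hlw' hl1 ew' ev' hs1
        rw [pw, pv]
        exact lift2 _ _ _ hHv hHw hs Lw hR
  have bwd : ∀ k : ℕ, ∀ v w, H v → H w → L w ≤ k → R v w → ∃ lw lv : List (Perm ℤ),
      ((∀ x ∈ lw, x ∈ S) ∧ lw.prod = w ∧ c * lw.length = L w) ∧
      ((∀ x ∈ lv, x ∈ S) ∧ lv.prod = v ∧ c * lv.length = L v) ∧ lv.Sublist lw := by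
    have h0 : ∀ v w, H v → w = 1 → R v w → ∃ lw lv : List (Perm ℤ),
      ((∀ x ∈ lw, x ∈ S) ∧ lw.prod = w ∧ c * lw.length = L w) ∧
      ((∀ x ∈ lv, x ∈ S) ∧ lv.prod = v ∧ c * lv.length = L v) ∧ lv.Sublist lw := by
      rintro v w hv rfl hR
      have := R1 v hv hR
      subst this
      refine ⟨[], [], ?_, ?_, ?_⟩ <;> simp [L1]
    have hap : ∀ (l : List (Perm ℤ)) (w s : Perm ℤ), s ∈ S → L w = L (w * s) + c →
        ((∀ x ∈ l, x ∈ S) ∧ l.prod = w * s ∧ c * l.length = L (w * s)) →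
        ((∀ x ∈ l ++ [s], x ∈ S) ∧ (l ++ [s]).prod = w ∧ c * (l ++ [s]).length = L w) := by
      rintro l w s hs h ⟨a, b, d⟩
      refine ⟨?_, ?_, ?_⟩
      · intro x hx
        rw [List.mem_append, List.mem_singleton] at hx
        rcases hx with hx | rfl
        · exact a x hx
        · exact hs
      · rw [List.prod_append, List.prod_singleton, b, hcan s hs]
      · rw [List.length_append, List.length_singleton, mul_add, mul_one]
        omega
    intro k
    induction k with
    | zero =>
      intro v w hv hw hk hR
      by_cases e : w = 1
      · exact h0 v w hv e hR
      · obtain ⟨s, hs, h⟩ := hdesc w hw e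
        omega
    | succ k ih =>
      intro v w hv hw hk hR
      by_cases e : w = 1
      · exact h0 v w hv e hR
      · obtain ⟨s, hs, h⟩ := hdesc w hw e
        rcases hL v s hv hs with hu | hd
        · obtain ⟨lw, lv, a, b, d⟩ := ih v (w * s) hv (hH _ _ hw hs) (by omega)
            (lift3 v w s hv hw hs hu h hR)
          exact ⟨lw ++ [s], lv, hap lw w s hs h a, b, d.trans (List.sublist_append_left _ _)⟩
        · obtain ⟨lw, lv, a, b, d⟩ := ih (v * s) (w * s) (hH _ _ hv hs) (hH _ _ hw hs) (by omega)
            (lift1 v w s hv hw hs hd h hR)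
          exact ⟨lw ++ [s], lv ++ [s], hap lw w s hs h a, hap lv v s hs hd b,
            d.append (List.Sublist.refl _)⟩
  constructor
  · rintro ⟨lw, lv, a, b, d⟩
    obtain ⟨a1, a2, a3⟩ := (hred _ _ hw).1 a
    obtain ⟨b1, b2, b3⟩ := (hred _ _ hv).1 b
    subst a2 b2
    exact fwd lw lv a1 b1 a3 b3 d
  · intro hR
    obtain ⟨lw, lv, a, b, d⟩ := bwd _ v w hv hw le_rfl hR
    exact ⟨lw, lv, (hred _ _ hw).2 a, (hred _ _ hv).2 b, d⟩

lemma HA_swap {n : ℕ} {a b : ℤ} (h : Adj n a b) {w : Perm ℤ} (hw : HA n w) :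
    HA n (w * swap a b) := by
  intro i hi
  have h1 : i ≠ a := by rintro rfl; exact hi h.1
  have h2 : i ≠ b := by rintro rfl; exact hi h.2.1
  rw [Perm.mul_apply, swap_apply_of_ne_of_ne h1 h2]
  exact hw i hi

lemma ne_of_adj {n : ℕ} {a b : ℤ} (h : Adj n a b) (w : Perm ℤ) : w a ≠ w b := by
  intro e
  have := w.injective e
  have := h.2.2.1
  omega

lemma inv_one (n : ℕ) : inv n 1 = 0 := by
  unfold inv
  rw [Finset.card_eq_zero, Finset.filter_eq_empty_iff]
  intro x _
  rw [Perm.one_apply, Perm.one_apply]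
  omega

lemma sGen_adj {n : ℕ} {s : Perm ℤ} (h : s ∈ sGen n) : ∃ a b, Adj n a b ∧ s = swap a b := by
  obtain ⟨i, h1, h2, h3, rfl⟩ := h
  exact ⟨i, nxt i, adj_nxt h1 h2 h3, rfl⟩

theorem main_A (n : ℕ) (v w : Perm ℤ) (hv : HA n v) (hw : HA n w) :
    BruhatLe (sGen n) v w ↔ R n v w := by
  have dn : ∀ {a b : ℤ} (_ : Adj n a b) (w : Perm ℤ), inv n w = inv n (w * swap a b) + 1 →
      w b < w a := by
    intro a b h w e
    by_contra hc
    have := inv_up h w (lt_of_le_of_ne (not_lt.1 hc) (ne_of_adj h w))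
    omega
  have up : ∀ {a b : ℤ} (_ : Adj n a b) (w : Perm ℤ), inv n (w * swap a b) = inv n w + 1 →
      w a < w b := by
    intro a b h w e
    by_contra hc
    have := inv_down h w (lt_of_le_of_ne (not_lt.1 hc) (ne_of_adj h w).symm)
    omega
  apply main (sGen n) (HA n) (inv n) 1 one_pos (R n)
  · intro i _; rfl
  · intro w s hw hs
    obtain ⟨a, b, h, rfl⟩ := sGen_adj hs
    exact HA_swap h hw
  · intro s hs
    obtain ⟨a, b, h, rfl⟩ := sGen_adj hs
    exact swap_mul_self _ _
  · exact inv_one n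
  · intro w s hw hs
    obtain ⟨a, b, h, rfl⟩ := sGen_adj hs
    rcases lt_or_gt_of_ne (ne_of_adj h w) with e | e
    · exact Or.inl (inv_up h w e)
    · exact Or.inr (inv_down h w e)
  · intro w hw hne
    by_contra hc
    apply hne
    apply no_desc hw
    intro i h1 h2 h3
    have h := adj_nxt h1 h2 h3
    by_contra hlt
    apply hc
    exact ⟨swap i (nxt i), ⟨i, h1, h2, h3, rfl⟩,
      inv_down h w (lt_of_le_of_ne (not_lt.1 hlt) (ne_of_adj h w).symm)⟩
  · exact R_refl n
  · intro u v w; exact R_trans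
  · intro v s hv hs e
    obtain ⟨a, b, h, rfl⟩ := sGen_adj hs
    exact R_down h v (dn h v e)
  · intro v w s hv hw hs e1 e2
    obtain ⟨a, b, h, rfl⟩ := sGen_adj hs
    exact lift_dd h v w (dn h v e1) (dn h w e2)
  · intro v w s hv hw hs e1
    obtain ⟨a, b, h, rfl⟩ := sGen_adj hs
    exact lift_uu h v w (up h w e1)
  · intro v w s hv hw hs e1 e2
    obtain ⟨a, b, h, rfl⟩ := sGen_adj hs
    exact lift_ud h v w (up h v e1)
  · intro v hv; exact R_one hv
  · exact hv
  · exact hw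

lemma HA_of_Bn {n : ℕ} {w : Perm ℤ} (h : IsBn n w) : HA n w := by
  intro i hi
  by_cases h0 : i = 0
  · subst h0
    have := h.1 0
    simp at this
    omega
  · apply h.2
    rw [mem_D] at hi
    rw [lt_abs]
    omega

/-- Number of negative values in the window. -/
noncomputable def neg (n : ℕ) (w : Perm ℤ) : ℕ := ((Finset.Icc (1 : ℤ) n).filter (fun i => w i < 0)).card

/-- Twice the length function of `B_n`. -/
noncomputable def LB (n : ℕ) (w : Perm ℤ) : ℕ := inv n w + neg n w

lemma neg_one (n : ℕ) : neg n 1 = 0 := by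
  unfold neg
  rw [Finset.card_eq_zero, Finset.filter_eq_empty_iff]
  intro x hx
  rw [Finset.mem_Icc] at hx
  rw [Perm.one_apply]
  omega

lemma neg_t {n : ℕ} (hn : 1 ≤ n) {w : Perm ℤ} (h : IsBn n w) (h1 : 0 < w 1) :
    neg n (w * swap (-1) 1) = neg n w + 1 := by
  have hm := h.1 1
  unfold neg
  rw [← Finset.card_insert_of_notMem (a := (1 : ℤ))]
  · congr 1
    ext k
    simp only [Finset.mem_insert, Finset.mem_filter, Finset.mem_Icc]
    simp only [Perm.mul_apply]
    by_cases e : k = 1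
    · subst e
      simp only [swap_apply_right, hm, true_or, iff_true]
      omega
    · by_cases e2 : k = -1
      · subst e2; omega
      · rw [swap_apply_of_ne_of_ne e2 e]
        simp [e]
  · simp
    intro _; omega

lemma neg_s {n : ℕ} {i : ℤ} (h1 : 1 ≤ i) (h2 : i ≤ (n : ℤ) - 1) (w : Perm ℤ) :
    neg n (w * swap i (i + 1) * swap (-(i + 1)) (-i)) = neg n w := by
  unfold neg
  rw [← Finset.card_map (swap i (i + 1)).toEmbedding]
  congr 1
  ext k
  rw [Finset.mem_map_equiv, symm_swap]
  simp only [Finset.mem_filter, Finset.mem_Icc]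
  simp only [Perm.mul_apply]
  have e1 : (1 ≤ swap i (i + 1) k ∧ swap i (i + 1) k ≤ n) ↔ (1 ≤ k ∧ k ≤ n) := by
    rw [swap_apply_def]; split_ifs <;> omega
  rw [e1]
  apply and_congr_right
  intro hk
  have h3 : 1 ≤ swap i (i + 1) k := (e1.2 hk).1
  rw [swap_apply_of_ne_of_ne (a := -(i + 1)) (by omega) (by omega), swap_apply_self]

/-- The generators of type B, normalised. -/
lemma bGen_cases {n : ℕ} {s : Perm ℤ} (h : s ∈ bGen n) :
    s = swap (-1) 1 ∨ ∃ i : ℤ, 1 ≤ i ∧ i ≤ (n : ℤ) - 1 ∧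
      s = swap i (i + 1) * swap (-(i + 1)) (-i) := by
  rcases h with rfl | ⟨i, h1, h2, rfl⟩
  · left; exact swap_comm _ _
  · right; exact ⟨i, h1, h2, by rw [swap_comm (-i)]⟩

lemma adj_t {n : ℕ} (hn : 1 ≤ n) : Adj n (-1) 1 := by
  have := adj_nxt (n := n) (i := -1) (by omega) (by omega) (by omega)
  simpa [nxt] using this

lemma adj_p {n : ℕ} {i : ℤ} (h1 : 1 ≤ i) (h2 : i ≤ (n : ℤ) - 1) : Adj n i (i + 1) := by
  have := adj_nxt (n := n) (i := i) (by omega) (by omega) (by omega)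
  rwa [nxt, if_neg (by omega)] at this

lemma adj_m {n : ℕ} {i : ℤ} (h1 : 1 ≤ i) (h2 : i ≤ (n : ℤ) - 1) : Adj n (-(i + 1)) (-i) := by
  have := adj_nxt (n := n) (i := -(i + 1)) (by omega) (by omega) (by omega)
  rw [nxt, if_neg (by omega)] at this
  convert this using 1
  ring

lemma val_m {n : ℕ} {i : ℤ} (h1 : 1 ≤ i) {w : Perm ℤ} (h : IsBn n w) :
    (w * swap i (i + 1)) (-(i + 1)) = - w (i + 1) ∧ (w * swap i (i + 1)) (-i) = - w i := by
  constructor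
  · rw [Perm.mul_apply, swap_apply_of_ne_of_ne (by omega) (by omega), h.1]
  · rw [Perm.mul_apply, swap_apply_of_ne_of_ne (by omega) (by omega), h.1]

lemma Bn_t {n : ℕ} (hn : 1 ≤ n) {w : Perm ℤ} (h : IsBn n w) : IsBn n (w * swap (-1) 1) := by
  refine ⟨?_, ?_⟩
  · intro i
    rw [Perm.mul_apply, Perm.mul_apply, ← h.1]
    congr 1
    simp only [swap_apply_def]
    split_ifs <;> omega
  · intro i hi
    rw [Perm.mul_apply]
    rw [lt_abs] at hi
    rw [swap_apply_of_ne_of_ne (by omega) (by omega)]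
    exact h.2 i (lt_abs.2 hi)

lemma Bn_s {n : ℕ} {i : ℤ} (h1 : 1 ≤ i) (h2 : i ≤ (n : ℤ) - 1) {w : Perm ℤ} (h : IsBn n w) :
    IsBn n (w * (swap i (i + 1) * swap (-(i + 1)) (-i))) := by
  refine ⟨?_, ?_⟩
  · intro k
    simp only [Perm.mul_apply]
    rw [← h.1]
    congr 1
    simp only [swap_apply_def]
    split_ifs <;> omega
  · intro k hk
    rw [Perm.mul_apply, Perm.mul_apply]
    rw [lt_abs] at hk
    rw [swap_apply_of_ne_of_ne (a := -(i + 1)) (by omega) (by omega),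
      swap_apply_of_ne_of_ne (by omega) (by omega)]
    exact h.2 k (lt_abs.2 hk)

lemma LB_t_up {n : ℕ} (hn : 1 ≤ n) {w : Perm ℤ} (h : IsBn n w) (h1 : 0 < w 1) :
    LB n (w * swap (-1) 1) = LB n w + 2 := by
  have hm := h.1 1
  have a := inv_up (adj_t hn) w (by omega)
  have b := neg_t hn h h1
  unfold LB
  omega

lemma LB_t_down {n : ℕ} (hn : 1 ≤ n) {w : Perm ℤ} (h : IsBn n w) (h1 : w 1 < 0) :
    LB n w = LB n (w * swap (-1) 1) + 2 := by
  have hm := h.1 1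
  have := LB_t_up hn (Bn_t hn h) (by rw [Perm.mul_apply, swap_apply_right, hm]; omega)
  rwa [mul_swap_cancel] at this

lemma LB_s_up {n : ℕ} {i : ℤ} (h1 : 1 ≤ i) (h2 : i ≤ (n : ℤ) - 1) {w : Perm ℤ} (h : IsBn n w)
    (hw : w i < w (i + 1)) :
    LB n (w * (swap i (i + 1) * swap (-(i + 1)) (-i))) = LB n w + 2 := by
  have a := inv_up (adj_p h1 h2) w hw
  have v := val_m h1 h
  have b := inv_up (adj_m h1 h2) (w * swap i (i + 1)) (by rw [v.1, v.2]; omega)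
  have c := neg_s h1 h2 w
  rw [← mul_assoc]
  unfold LB
  omega

lemma LB_s_down {n : ℕ} {i : ℤ} (h1 : 1 ≤ i) (h2 : i ≤ (n : ℤ) - 1) {w : Perm ℤ} (h : IsBn n w)
    (hw : w (i + 1) < w i) :
    LB n w = LB n (w * (swap i (i + 1) * swap (-(i + 1)) (-i))) + 2 := by
  have a := inv_down (adj_p h1 h2) w hw
  have v := val_m h1 h
  have b := inv_down (adj_m h1 h2) (w * swap i (i + 1)) (by rw [v.1, v.2]; omega)
  have c := neg_s h1 h2 w
  rw [← mul_assoc]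
  unfold LB
  omega

lemma Bn_ne {n : ℕ} {w : Perm ℤ} (h : IsBn n w) : w 1 ≠ 0 := by
  intro e
  have h0 := h.1 0
  simp at h0
  have : w 0 = 0 := by omega
  have := w.injective (e.trans this.symm)
  omega

theorem main_B (n : ℕ) (hn : 1 ≤ n) (v w : Perm ℤ) (hv : IsBn n v) (hw : IsBn n w) :
    BruhatLe (bGen n) v w ↔ R n v w := by
  have td : ∀ w : Perm ℤ, IsBn n w → LB n w = LB n (w * swap (-1) 1) + 2 → w 1 < w (-1) := by
    intro w h e
    rw [h.1]
    by_contra hc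
    have := Bn_ne h
    have := LB_t_up hn h (by omega)
    omega
  have tu : ∀ w : Perm ℤ, IsBn n w → LB n (w * swap (-1) 1) = LB n w + 2 → w (-1) < w 1 := by
    intro w h e
    rw [h.1]
    by_contra hc
    have := Bn_ne h
    have := LB_t_down hn h (by omega)
    omega
  have sd : ∀ (w : Perm ℤ) (i : ℤ), IsBn n w → 1 ≤ i → i ≤ (n : ℤ) - 1 →
      LB n w = LB n (w * (swap i (i + 1) * swap (-(i + 1)) (-i))) + 2 → w (i + 1) < w i ∧
      (w * swap i (i + 1)) (-i) < (w * swap i (i + 1)) (-(i + 1)) := by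
    intro w i h h1 h2 e
    have v := val_m h1 h
    rw [v.1, v.2]
    by_contra hc
    have := ne_of_adj (adj_p h1 h2) w
    have := LB_s_up h1 h2 h (by omega)
    omega
  have su : ∀ (w : Perm ℤ) (i : ℤ), IsBn n w → 1 ≤ i → i ≤ (n : ℤ) - 1 →
      LB n (w * (swap i (i + 1) * swap (-(i + 1)) (-i))) = LB n w + 2 → w i < w (i + 1) ∧
      (w * swap i (i + 1)) (-(i + 1)) < (w * swap i (i + 1)) (-i) ∧ w (-(i + 1)) < w (-i) := by
    intro w i h h1 h2 e
    have v := val_m h1 h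
    rw [v.1, v.2, h.1, h.1]
    by_contra hc
    have := ne_of_adj (adj_p h1 h2) w
    have := LB_s_down h1 h2 h (by omega)
    omega
  apply main (bGen n) (IsBn n) (LB n) 2 two_pos (R n)
  · exact ⟨fun i => rfl, fun i _ => rfl⟩
  · intro w s hw hs
    rcases bGen_cases hs with rfl | ⟨i, h1, h2, rfl⟩
    · exact Bn_t hn hw
    · exact Bn_s h1 h2 hw
  · intro s hs
    rcases bGen_cases hs with rfl | ⟨i, h1, h2, rfl⟩
    · exact swap_mul_self _ _
    · ext k
      simp only [swap_apply_def, Perm.mul_apply, Perm.one_apply]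
      split_ifs <;> omega
  · simp [LB, inv_one, neg_one]
  · intro w s hw hs
    rcases bGen_cases hs with rfl | ⟨i, h1, h2, rfl⟩
    · rcases lt_or_gt_of_ne (Bn_ne hw) with e | e
      · exact Or.inr (LB_t_down hn hw e)
      · exact Or.inl (LB_t_up hn hw e)
    · rcases lt_or_gt_of_ne (ne_of_adj (adj_p h1 h2) w) with e | e
      · exact Or.inl (LB_s_up h1 h2 hw e)
      · exact Or.inr (LB_s_down h1 h2 hw e)
  · intro w hw hne
    by_contra hc
    apply hne
    have ht : w (-1) < w 1 := by
      rw [hw.1]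
      by_contra hlt
      apply hc
      have := Bn_ne hw
      exact ⟨swap (-1) 1, Or.inl (swap_comm _ _), LB_t_down hn hw (by omega)⟩
    have hp : ∀ i : ℤ, 1 ≤ i → i ≤ (n : ℤ) - 1 → w i < w (i + 1) := by
      intro i h1 h2
      by_contra hlt
      apply hc
      have := ne_of_adj (adj_p h1 h2) w
      exact ⟨_, Or.inr ⟨i, h1, h2, by rw [swap_comm (-i)]⟩, LB_s_down h1 h2 hw (by omega)⟩
    apply no_desc (HA_of_Bn hw)
    intro i h1 h2 h3
    by_cases e : i = -1
    · subst e; simpa [nxt] using ht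
    · rw [nxt, if_neg e]
      by_cases hi : 0 < i
      · exact hp i (by omega) h2
      · have h4 := hp (-(i + 1)) (by omega) (by omega)
        have e1 : -(i + 1) + 1 = -i := by ring
        rw [e1, hw.1, hw.1] at h4
        omega
  · exact R_refl n
  · intro u v w; exact R_trans
  · intro v s hv hs e
    rcases bGen_cases hs with rfl | ⟨i, h1, h2, rfl⟩
    · exact R_down (adj_t hn) v (td v hv e)
    · have ⟨a, b⟩ := sd v i hv h1 h2 e
      rw [← mul_assoc]
      exact R_trans (R_down (adj_m h1 h2) _ b) (R_down (adj_p h1 h2) v a)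
  · intro v w s hv hw hs e1 e2 hR
    rcases bGen_cases hs with rfl | ⟨i, h1, h2, rfl⟩
    · exact lift_dd (adj_t hn) v w (td v hv e1) (td w hw e2) hR
    · have ⟨a, b⟩ := sd v i hv h1 h2 e1
      have ⟨a', b'⟩ := sd w i hw h1 h2 e2
      rw [← mul_assoc, ← mul_assoc]
      exact lift_dd (adj_m h1 h2) _ _ b b' (lift_dd (adj_p h1 h2) v w a a' hR)
  · intro v w s hv hw hs e1 hR
    rcases bGen_cases hs with rfl | ⟨i, h1, h2, rfl⟩
    · exact lift_uu (adj_t hn) v w (tu w hw e1) hR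
    · have ⟨a, b, _⟩ := su w i hw h1 h2 e1
      rw [← mul_assoc, ← mul_assoc]
      exact lift_uu (adj_m h1 h2) _ _ b (lift_uu (adj_p h1 h2) v w a hR)
  · intro v w s hv hw hs e1 e2 hR
    rcases bGen_cases hs with rfl | ⟨i, h1, h2, rfl⟩
    · exact lift_ud (adj_t hn) v w (tu v hv e1) hR
    · have ⟨a, _, b⟩ := su v i hv h1 h2 e1
      rw [← mul_assoc]
      exact lift_ud (adj_m h1 h2) _ _ b (lift_ud (adj_p h1 h2) v w a hR)
  · intro v hv; exact R_one (HA_of_Bn hv)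
  · exact hv
  · exact hw

end BruhatAux

/-- For `v, w ∈ B_n`, we have `v ≤ w` in the Bruhat order of `B_n`
if and only if `v ≤ w` in the Bruhat order of the symmetric group of all permutations of
`{-n, …, -1, 1, …, n}`. -/
theorem stmt_2 (n : ℕ) (hn : 1 ≤ n) (v w : Equiv.Perm ℤ)
    (hv : IsBn n v) (hw : IsBn n w) :
    BruhatLe (bGen n) v w ↔ BruhatLe (sGen n) v w :=
  (BruhatAux.main_B n hn v w hv hw).trans
    (BruhatAux.main_A n v w (BruhatAux.HA_of_Bn hv) (BruhatAux.HA_of_Bn hw)).symm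
end

section
/- For every n ≥ 1, the number of elements w of B_n whose window avoids the five signed patterns 1 2̄, 2̄ 1, 2̄ 1̄, 3 1 2, 3 1̄ 2 equals the Catalan number (1/(n+2))·binomial(2n+2, n+1). -/
open scoped BigOperators

namespace Five

/-- two-letter condition (reversed window: `x` stands after `y` in the window). -/
def PP (x y : ℤ) : Prop :=
  ¬ (0 < y ∧ x < 0 ∧ y < -x) ∧ ¬ (y < 0 ∧ 0 < x ∧ x < -y) ∧ ¬ (y < x ∧ x < 0)

/-- three-letter condition (reversed window). -/
def RR (z y x : ℤ) : Prop :=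
  ¬ (0 < y ∧ y < z ∧ z < x) ∧ ¬ (y < 0 ∧ 0 < z ∧ z < x ∧ -y < z)

def Tri : List ℤ → Prop
  | [] => True
  | z :: t => t.Pairwise (RR z) ∧ Tri t

def pl : ℕ → List ℕ
  | 0 => []
  | n + 1 => (n + 1) :: pl n

def win (w : ℤ → ℤ) : ℕ → List ℤ
  | 0 => []
  | n + 1 => w ((n : ℤ) + 1) :: win w n

def Good (n : ℕ) (r : List ℤ) : Prop :=
  (r.map Int.natAbs).Perm (pl n) ∧ r.Pairwise PP ∧ Tri r

abbrev DD (z y : ℤ) : Prop := z < 0 ∨ z < y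

def LL (r : List ℤ) : ℕ := Nat.findGreatest (fun k => (r.take k).Pairwise DD) r.length

def lab (r : List ℤ) : ℕ := if ∀ x ∈ r, x < 0 then r.length + 1 else LL r

def child (n : ℕ) (r : List ℤ) (i : ℕ) : List ℤ :=
  if i ≤ r.length then r.take i ++ ((n : ℤ) + 1) :: r.drop i else (-((n : ℤ) + 1)) :: r

def SS : ℕ → Finset (List ℤ)
  | 0 => {[]}
  | n + 1 => (SS n).biUnion fun w => (Finset.range (lab w + 1)).image (child n w)

def TT : ℕ → ℕ → ℕ
  | _, 0 => 1
  | L, m + 1 => ∑ i ∈ Finset.range (L + 1), TT (i + 1) m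

/-! numbers -/

lemma TT_zero (m : ℕ) : TT 0 (m + 1) = TT 1 m := by simp [TT]

lemma TT_succ (L m : ℕ) : TT (L + 1) (m + 1) = TT L (m + 1) + TT (L + 2) m := by
  simp only [TT]
  rw [Finset.sum_range_succ _ (L + 1)]

lemma TT_choose (m : ℕ) : ∀ L, TT L (m + 1) + (2 * m + 2 + L).choose m
    = (2 * m + 2 + L).choose (m + 1) := by
  induction m with
  | zero => intro L; simp [TT]; omega
  | succ m ih =>
    intro L
    induction L with
    | zero =>
      rw [TT_zero]
      have h := ih 1
      have e1 : 2 * (m + 1) + 2 + 0 = (2 * m + 2 + 1) + 1 := by ring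
      rw [e1, Nat.choose_succ_succ (2 * m + 2 + 1) m, Nat.choose_succ_succ (2 * m + 2 + 1) (m + 1)]
      have : (2 * m + 2 + 1).choose (m + 1 + 1) = (2 * m + 2 + 1).choose (m + 1) :=
        Nat.choose_symm_of_eq_add (by ring)
      simp only [Nat.succ_eq_add_one] at *
      omega
    | succ L ihL =>
      rw [TT_succ]
      have h := ih (L + 2)
      have e1 : 2 * (m + 1) + 2 + (L + 1) = (2 * m + 2 + (L + 2)) + 1 := by ring
      have e2 : 2 * (m + 1) + 2 + L = 2 * m + 2 + (L + 2) := by ring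
      rw [e2] at ihL
      rw [e1, Nat.choose_succ_succ _ m, Nat.choose_succ_succ _ (m + 1)]
      simp only [Nat.succ_eq_add_one] at *
      omega

lemma TT_catalan (n : ℕ) : TT 1 n * (n + 2) = (2 * n + 2).choose (n + 1) := by
  rw [← TT_zero]
  have h := TT_choose n 0
  have h2 := Nat.choose_succ_right_eq (2 * n + 2) n
  rw [show 2 * n + 2 - n = n + 2 by omega] at h2
  simp only [add_zero] at h
  nlinarith

/-! lists -/

lemma mem_pl {n k : ℕ} : k ∈ pl n ↔ 1 ≤ k ∧ k ≤ n := by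
  induction n with
  | zero => simp [pl]; omega
  | succ n ih => simp [pl, ih]; omega

lemma nodup_pl (n : ℕ) : (pl n).Nodup := by
  induction n with
  | zero => simp [pl]
  | succ n ih => simp [pl, ih, mem_pl]

lemma length_pl (n : ℕ) : (pl n).length = n := by
  induction n with
  | zero => simp [pl]
  | succ n ih => simp [pl, ih]

lemma Good.length {n r} (h : Good n r) : r.length = n := by
  have := h.1.length_eq
  simpa [length_pl] using this

lemma Good.bound {n r} (h : Good n r) {x : ℤ} (hx : x ∈ r) : 1 ≤ x.natAbs ∧ x.natAbs ≤ n :=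
  mem_pl.1 (h.1.subset (List.mem_map_of_mem hx))

lemma Good.ndp {n r} (h : Good n r) : r.Pairwise (fun x y => x.natAbs ≠ y.natAbs) := by
  have := h.1.nodup_iff.2 (nodup_pl n)
  exact List.pairwise_map.1 this

lemma tri_mid (a b : List ℤ) (M : ℤ) : Tri (a ++ M :: b) ↔
    Tri (a ++ b) ∧ a.Pairwise (fun z y => RR z y M) ∧ (∀ z ∈ a, ∀ x ∈ b, RR z M x) ∧
      b.Pairwise (RR M) := by
  induction a with
  | nil => simp [Tri]; tauto
  | cons z a ih =>
    simp only [List.cons_append, Tri, ih, List.pairwise_append, List.pairwise_cons,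
      List.mem_cons, forall_eq_or_imp]
    constructor
    · rintro ⟨⟨h1, ⟨h2, h3⟩, h4⟩, h5, h6, h7, h8⟩
      exact ⟨⟨⟨h1, h3, fun a ha => (h4 a ha).2⟩, h5⟩, ⟨fun a ha => (h4 a ha).1, h6⟩, ⟨h2, h7⟩, h8⟩
    · rintro ⟨⟨⟨h1, h3, h4⟩, h5⟩, ⟨h9, h6⟩, ⟨h2, h7⟩, h8⟩
      exact ⟨⟨h1, ⟨h2, h3⟩, fun a ha => ⟨h9 a ha, h4 a ha⟩⟩, h5, h6, h7, h8⟩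

lemma le_LL {r : List ℤ} {i : ℕ} : i ≤ LL r ↔ i ≤ r.length ∧ (r.take i).Pairwise DD := by
  constructor
  · intro h
    have h1 : LL r ≤ r.length := Nat.findGreatest_le _
    have h2 : (r.take (LL r)).Pairwise DD :=
      Nat.findGreatest_spec (P := fun k => (r.take k).Pairwise DD) (Nat.zero_le _) (by simp)
    exact ⟨h.trans h1, h2.sublist (List.take_sublist_take_left h)⟩
  · rintro ⟨h1, h2⟩
    exact Nat.le_findGreatest h1 h2

lemma pw_neg {r : List ℤ} (h : ∀ x ∈ r, x < 0) : r.Pairwise DD :=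
  List.Pairwise.imp_of_mem (R := fun _ _ => True) (fun ha _ _ => Or.inl (h _ ha))
    (List.pairwise_of_forall (by simp))

lemma le_lab_of {r : List ℤ} {i : ℕ} (h : i ≤ LL r) : i ≤ lab r := by
  unfold lab
  split_ifs
  · have := (le_LL.1 h).1; omega
  · exact h

lemma of_le_lab {r : List ℤ} {i : ℕ} (h : i ≤ lab r) :
    (i ≤ r.length ∧ (r.take i).Pairwise DD) ∨ (i = r.length + 1 ∧ ∀ x ∈ r, x < 0) := by
  unfold lab at h
  split_ifs at h with h1
  · rcases Nat.lt_or_ge r.length i with h2 | h2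
    · right; exact ⟨by omega, h1⟩
    · left; exact ⟨h2, (pw_neg h1).sublist (List.take_sublist _ _)⟩
  · left; exact le_LL.1 h

lemma lab_child {n r} (hg : Good n r) {i : ℕ} (h : i ≤ lab r) : lab (child n r i) = i + 1 := by
  rcases of_le_lab h with ⟨h1, h2⟩ | ⟨h1, h2⟩
  · have hc : child n r i = r.take i ++ ((n : ℤ) + 1) :: r.drop i := by simp [child, h1]
    have hnn : ¬ ∀ x ∈ child n r i, x < 0 := by
      intro hh
      have := hh ((n : ℤ) + 1) (by rw [hc]; simp)
      omega
    have hlen : (r.take i).length = i := by simp [h1]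
    rw [lab, if_neg hnn]
    apply le_antisymm
    · by_contra hlt
      have h3 : i + 2 ≤ LL (child n r i) := by omega
      obtain ⟨h4, h5⟩ := le_LL.1 h3
      rw [hc] at h4 h5
      rw [List.take_append, hlen, show i + 2 - i = 2 by omega] at h5
      have h6 := (List.pairwise_append.1 h5).2.1
      rcases hd : r.drop i with _ | ⟨y, t⟩
      · exfalso; rw [hd] at h4; simp at h4
      · rw [hd] at h6
        simp at h6
        have hy : y ∈ r := List.mem_of_mem_drop (i := i) (by rw [hd]; simp)
        have := hg.bound hy
        omega
    · apply le_LL.2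
      rw [hc]
      refine ⟨by simp; omega, ?_⟩
      rw [List.take_append, hlen, show i + 1 - i = 1 by omega]
      rw [List.take_of_length_le (by omega)]
      refine List.pairwise_append.2 ⟨h2, by simp, ?_⟩
      intro z hz y hy
      have := hg.bound (List.mem_of_mem_take hz)
      simp at hy
      right; omega
  · have hc : child n r i = (-((n : ℤ) + 1)) :: r := by simp [child, h1]
    rw [hc, lab, if_pos]
    · simp [h1]
    · intro x hx
      rcases List.mem_cons.1 hx with rfl | hx
      · omega
      · exact h2 x hx

lemma child_inj {n r r' i i'} (hg : Good n r) (hg' : Good n r') (h : i ≤ lab r) (h' : i' ≤ lab r')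
    (e : child n r i = child n r' i') : r = r' ∧ i = i' := by
  have e1 := lab_child hg h
  rw [e, lab_child hg' h'] at e1
  have e2 : i = i' := by omega
  subst e2
  refine ⟨?_, rfl⟩
  have l := hg.length
  have l' := hg'.length
  unfold child at e
  rw [l, l'] at e
  split_ifs at e with hi
  · obtain ⟨a1, a2⟩ := List.append_inj e (by simp [l, l'])
    rw [← List.take_append_drop i r, ← List.take_append_drop i r', a1, (List.cons.inj a2).2]
  · exact (List.cons.inj e).2

lemma good_child {n r i} (hg : Good n r) (h : i ≤ lab r) : Good (n + 1) (child n r i) := by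
  rcases of_le_lab h with ⟨h1, h2⟩ | ⟨h1, h2⟩
  · have hc : child n r i = r.take i ++ ((n : ℤ) + 1) :: r.drop i := by simp [child, h1]
    rw [hc]
    have hr := List.take_append_drop i r
    generalize r.take i = a at *
    generalize r.drop i = b at *
    subst hr
    have hb : ∀ x ∈ a ++ b, 1 ≤ x.natAbs ∧ x.natAbs ≤ n := fun x hx => hg.bound hx
    have hba : ∀ x ∈ a, 1 ≤ x.natAbs ∧ x.natAbs ≤ n := fun x hx => hb x (by simp [hx])
    have hbb : ∀ x ∈ b, 1 ≤ x.natAbs ∧ x.natAbs ≤ n := fun x hx => hb x (by simp [hx])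
    refine ⟨?_, ?_, ?_⟩
    · refine (List.perm_middle.map _).trans ?_
      have : ((n : ℤ) + 1).natAbs = n + 1 := by omega
      simp only [List.map_cons, pl, this]
      exact hg.1.cons _
    · obtain ⟨p1, p2, p3⟩ := List.pairwise_append.1 hg.2.1
      refine List.pairwise_append.2 ⟨p1, List.pairwise_cons.2 ⟨?_, p2⟩, ?_⟩
      · intro y hy; have := hbb y hy; unfold PP; omega
      · intro x hx y hy
        rcases List.mem_cons.1 hy with rfl | hy
        · have := hba x hx; unfold PP; omega
        · exact p3 x hx y hy
    · refine (tri_mid _ _ _).2 ⟨hg.2.2, ?_, ?_, ?_⟩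
      · refine h2.imp_of_mem ?_
        intro z y hz hy hd
        have := hba z hz; have := hba y hy
        unfold RR; unfold DD at hd; omega
      · intro z hz x hx
        have := hba z hz; have := hbb x hx
        unfold RR; omega
      · refine List.Pairwise.imp_of_mem (R := fun _ _ => True) (fun {x y} hx hy _ => ?_)
          (List.pairwise_of_forall (by simp))
        have := hbb x hx; have := hbb y hy
        unfold RR; omega
  · have hc : child n r i = (-((n : ℤ) + 1)) :: r := by simp [child, h1]
    rw [hc]
    refine ⟨?_, ?_, ?_, hg.2.2⟩
    · have : (-((n : ℤ) + 1)).natAbs = n + 1 := by omega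
      simp only [List.map_cons, pl, this]
      exact hg.1.cons _
    · refine List.pairwise_cons.2 ⟨?_, hg.2.1⟩
      intro y hy
      have := hg.bound hy; have := h2 y hy
      unfold PP; omega
    · refine List.Pairwise.imp_of_mem (R := fun _ _ => True) (fun {x y} hx hy _ => ?_)
        (List.pairwise_of_forall (by simp))
      have := h2 x hx; have := h2 y hy
      unfold RR; omega

lemma exists_child {n v} (hv : Good (n + 1) v) :
    ∃ r, Good n r ∧ ∃ i ≤ lab r, child n r i = v := by
  have hm : n + 1 ∈ v.map Int.natAbs := hv.1.symm.subset (by simp [pl])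
  obtain ⟨x, hx, hxn⟩ := List.mem_map.1 hm
  obtain ⟨a, b, rfl⟩ := List.append_of_mem hx
  have hg : Good n (a ++ b) := by
    refine ⟨?_, ?_, ((tri_mid _ _ _).1 hv.2.2).1⟩
    · have h := ((List.perm_middle (a := x) (l₁ := a) (l₂ := b)).map Int.natAbs).symm.trans hv.1
      simp only [List.map_cons, pl, hxn] at h
      exact h.cons_inv
    · exact hv.2.1.sublist (by simp)
  have hba : ∀ y ∈ a, 1 ≤ y.natAbs ∧ y.natAbs ≤ n := fun y hy => hg.bound (by simp [hy])
  have hbb : ∀ y ∈ b, 1 ≤ y.natAbs ∧ y.natAbs ≤ n := fun y hy => hg.bound (by simp [hy])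
  obtain ⟨p1, p2, p3⟩ := List.pairwise_append.1 hv.2.1
  refine ⟨a ++ b, hg, ?_⟩
  rcases (by omega : x = (n : ℤ) + 1 ∨ x = -((n : ℤ) + 1)) with rfl | rfl
  · refine ⟨a.length, le_lab_of (le_LL.2 ⟨by simp, ?_⟩), by simp [child]⟩
    rw [List.take_left]
    have t := ((tri_mid _ _ _).1 hv.2.2).2.1
    have d := (List.pairwise_append.1 hg.ndp).1
    refine ((t.and d).and p1).imp_of_mem ?_
    rintro z y hz hy ⟨⟨h1, h2⟩, h3⟩
    have := hba z hz; have := hba y hy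
    unfold RR at h1; unfold PP at h3; unfold DD; omega
  · have ha : a = [] := by
      rw [List.eq_nil_iff_forall_not_mem]
      intro z hz
      have h1 := p3 z hz _ (List.mem_cons_self)
      have := hba z hz
      unfold PP at h1; omega
    subst ha
    have hneg : ∀ y ∈ b, y < 0 := by
      intro y hy
      have h1 := (List.pairwise_cons.1 p2).1 y hy
      have := hbb y hy
      unfold PP at h1; omega
    refine ⟨b.length + 1, ?_, by simp [child]⟩
    simp only [List.nil_append, lab, if_pos hneg, le_refl]

lemma mem_SS {n : ℕ} : ∀ {r}, r ∈ SS n ↔ Good n r := by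
  induction n with
  | zero =>
    intro r
    simp only [SS, Finset.mem_singleton]
    constructor
    · rintro rfl; simp [Good, pl, Tri]
    · intro h; exact List.length_eq_zero_iff.1 h.length
  | succ n ih =>
    intro r
    simp only [SS, Finset.mem_biUnion, Finset.mem_image, Finset.mem_range, ih]
    constructor
    · rintro ⟨w, hw, i, hi, rfl⟩
      exact good_child hw (by omega)
    · intro h
      obtain ⟨w, hw, i, hi, e⟩ := exists_child h
      exact ⟨w, hw, i, by omega, e⟩

lemma sum_SS (n : ℕ) : ∀ m, ∑ r ∈ SS n, TT (lab r) m = TT 1 (n + m) := by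
  induction n with
  | zero => intro m; simp [SS, lab]
  | succ n ih =>
    intro m
    rw [SS, Finset.sum_biUnion]
    · rw [show n + 1 + m = n + (m + 1) by ring, ← ih (m + 1)]
      refine Finset.sum_congr rfl fun r hr => ?_
      have hr := mem_SS.1 hr
      rw [Finset.sum_image, TT]
      · refine Finset.sum_congr rfl fun i hi => ?_
        rw [lab_child hr (by simp at hi; omega)]
      · intro i hi j hj e
        simp at hi hj
        exact (child_inj hr hr (by omega) (by omega) e).2
    · intro r hr r' hr' hne
      have hr := mem_SS.1 hr
      have hr' := mem_SS.1 hr'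
      refine Finset.disjoint_left.2 ?_
      intro v hv hv'
      simp only [Finset.mem_image, Finset.mem_range] at hv hv'
      obtain ⟨i, hi, rfl⟩ := hv
      obtain ⟨j, hj, e⟩ := hv'
      exact hne (child_inj hr' hr (by omega) (by omega) e).1.symm

lemma card_SS (n : ℕ) : (SS n).card = TT 1 n := by
  have := sum_SS n 0
  simpa [TT] using this

/-! windows -/

lemma mem_win {w : ℤ → ℤ} {n : ℕ} {x : ℤ} :
    x ∈ win w n ↔ ∃ i : ℤ, 1 ≤ i ∧ i ≤ n ∧ w i = x := by
  induction n with
  | zero => simp [win]; intros; omega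
  | succ n ih =>
    simp only [win, List.mem_cons, ih]
    constructor
    · rintro (rfl | ⟨i, h1, h2, h3⟩)
      · exact ⟨n + 1, by omega, by push_cast; omega, rfl⟩
      · exact ⟨i, h1, by push_cast; omega, h3⟩
    · rintro ⟨i, h1, h2, h3⟩
      push_cast at h2
      rcases (by omega : i = n + 1 ∨ i ≤ n) with rfl | h
      · left; exact h3.symm
      · right; exact ⟨i, h1, h, h3⟩

lemma length_win (w : ℤ → ℤ) (n : ℕ) : (win w n).length = n := by
  induction n with
  | zero => simp [win]
  | succ n ih => simp [win, ih]

lemma pairwise_win {w : ℤ → ℤ} {n : ℕ} {R : ℤ → ℤ → Prop} :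
    (win w n).Pairwise R ↔ ∀ i j : ℤ, 1 ≤ i → i < j → j ≤ n → R (w j) (w i) := by
  induction n with
  | zero => simp [win]; intros; omega
  | succ n ih =>
    simp only [win, List.pairwise_cons, ih, mem_win]
    constructor
    · rintro ⟨h1, h2⟩ i j hi hij hj
      push_cast at hj
      rcases (by omega : j = n + 1 ∨ j ≤ n) with rfl | h
      · exact h1 _ ⟨i, hi, by omega, rfl⟩
      · exact h2 i j hi hij h
    · intro h
      refine ⟨?_, fun i j hi hij hj => h i j hi hij (by push_cast; omega)⟩
      rintro _ ⟨i, h1, h2, rfl⟩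
      exact h i (n + 1) h1 (by omega) (by push_cast; omega)

lemma tri_win {w : ℤ → ℤ} {n : ℕ} :
    Tri (win w n) ↔ ∀ i j k : ℤ, 1 ≤ i → i < j → j < k → k ≤ n → RR (w k) (w j) (w i) := by
  induction n with
  | zero => simp [win, Tri]; intros; omega
  | succ n ih =>
    simp only [win, Tri, ih, pairwise_win]
    constructor
    · rintro ⟨h1, h2⟩ i j k hi hij hjk hk
      push_cast at hk
      rcases (by omega : k = n + 1 ∨ k ≤ n) with rfl | h
      · exact h1 i j hi hij (by omega)
      · exact h2 i j k hi hij hjk h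
    · intro h
      refine ⟨fun i j hi hij hj => h i j (n + 1) hi hij (by omega) (by push_cast; omega),
        fun i j k hi hij hjk hk => h i j k hi hij hjk (by push_cast; omega)⟩

lemma win_congr {w w' : ℤ → ℤ} {n : ℕ} :
    win w n = win w' n ↔ ∀ i : ℤ, 1 ≤ i → i ≤ n → w i = w' i := by
  induction n with
  | zero => simp [win]; intros; omega
  | succ n ih =>
    simp only [win, List.cons.injEq, ih]
    constructor
    · rintro ⟨h1, h2⟩ i hi hin
      push_cast at hin
      rcases (by omega : i = n + 1 ∨ i ≤ n) with rfl | h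
      · exact h1
      · exact h2 i hi h
    · intro h
      exact ⟨h _ (by omega) (by push_cast; omega), fun i h1 h2 => h i h1 (by push_cast; omega)⟩

lemma win_perm {n : ℕ} {w : Equiv.Perm ℤ} (h : IsBn n w) :
    ((win w n).map Int.natAbs).Perm (pl n) := by
  obtain ⟨h1, h2⟩ := h
  have w0 : w 0 = 0 := by have := h1 0; simp at this; omega
  have hnd : ((win w n).map Int.natAbs).Nodup := by
    refine List.pairwise_map.2 (pairwise_win.2 ?_)
    intro i j hi hij hj e
    rcases Int.natAbs_eq_natAbs_iff.1 e with e | e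
    · have := w.injective e; omega
    · rw [← h1] at e; have := w.injective e; omega
  refine (hnd.subperm ?_).perm_of_length_le (by simp [length_pl, length_win])
  intro k hk
  obtain ⟨x, hx, rfl⟩ := List.mem_map.1 hk
  obtain ⟨i, hi, hin, rfl⟩ := mem_win.1 hx
  refine mem_pl.2 ⟨?_, ?_⟩
  · by_contra hc
    have : w i = w 0 := by omega
    have := w.injective this
    omega
  · by_contra hc
    have := w.injective (h2 (w i) (by rw [Int.abs_eq_natAbs]; omega))
    omega

lemma avoids_iff {n : ℕ} {w : Equiv.Perm ℤ} :
    AvoidsFive n w ↔ (win w n).Pairwise PP ∧ Tri (win w n) := by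
  rw [pairwise_win, tri_win]
  unfold AvoidsFive Avoids12bar Avoids2bar1 Avoids2bar1bar Avoids312s Avoids31bar2 PP RR
  constructor
  · rintro ⟨a, b, c, d, e⟩
    refine ⟨fun i j hi hij hj => ⟨fun h => a ⟨i, j, hi, hij, hj, h⟩,
      fun h => b ⟨i, j, hi, hij, hj, h⟩, fun h => c ⟨i, j, hi, hij, hj, h⟩⟩,
      fun i j k hi hij hjk hk => ⟨fun h => d ⟨i, j, k, hi, hij, hjk, hk, h⟩,
      fun h => e ⟨i, j, k, hi, hij, hjk, hk, h⟩⟩⟩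
  · rintro ⟨a, b⟩
    refine ⟨?_, ?_, ?_, ?_, ?_⟩
    · rintro ⟨i, j, hi, hij, hj, h⟩; exact (a i j hi hij hj).1 h
    · rintro ⟨i, j, hi, hij, hj, h⟩; exact (a i j hi hij hj).2.1 h
    · rintro ⟨i, j, hi, hij, hj, h⟩; exact (a i j hi hij hj).2.2 h
    · rintro ⟨i, j, k, hi, hij, hjk, hk, h⟩; exact (b i j k hi hij hjk hk).1 h
    · rintro ⟨i, j, k, hi, hij, hjk, hk, h⟩; exact (b i j k hi hij hjk hk).2 h

/-- any list is the window of a function -/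
lemma exists_win (r : List ℤ) : ∃ g : ℤ → ℤ, win g r.length = r := by
  induction r with
  | nil => exact ⟨id, rfl⟩
  | cons x r ih =>
    obtain ⟨g, hg⟩ := ih
    refine ⟨fun i => if i = (r.length : ℤ) + 1 then x else g i, ?_⟩
    simp only [List.length_cons, win, if_true]
    congr 1
    refine (win_congr.2 ?_).trans hg
    intro i h1 h2
    rw [if_neg (by omega)]

lemma win_surj {n : ℕ} {r : List ℤ} (h : (r.map Int.natAbs).Perm (pl n)) :
    ∃ w : Equiv.Perm ℤ, IsBn n w ∧ win w n = r := by
  have hl : r.length = n := by simpa [length_pl] using h.length_eq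
  obtain ⟨g, hg⟩ := exists_win r
  rw [hl] at hg
  subst hg
  have hb : ∀ i : ℤ, 1 ≤ i → i ≤ n → 1 ≤ (g i).natAbs ∧ (g i).natAbs ≤ n := by
    intro i h1 h2
    exact mem_pl.1 (h.subset (List.mem_map_of_mem (mem_win.2 ⟨i, h1, h2, rfl⟩)))
  have hinj : ∀ i j : ℤ, 1 ≤ i → i ≤ n → 1 ≤ j → j ≤ n → (g i).natAbs = (g j).natAbs → i = j := by
    have := pairwise_win.1 (List.pairwise_map.1 (h.nodup_iff.2 (nodup_pl n)))
    intro i j hi hin hj hjn e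
    rcases lt_trichotomy i j with hij | hij | hij
    · exact absurd e.symm (this i j hi hij hjn)
    · exact hij
    · exact absurd e (this j i hj hij hin)
  have hsur : ∀ k : ℕ, 1 ≤ k → k ≤ n → ∃ i : ℤ, 1 ≤ i ∧ i ≤ n ∧ (g i).natAbs = k := by
    intro k h1 h2
    obtain ⟨x, hx, hxk⟩ := List.mem_map.1 (h.symm.subset (mem_pl.2 ⟨h1, h2⟩))
    obtain ⟨i, hi, hin, rfl⟩ := mem_win.1 hx
    exact ⟨i, hi, hin, hxk⟩
  let f : ℤ → ℤ := fun i => if 1 ≤ i ∧ i ≤ n then g i else if 1 ≤ -i ∧ -i ≤ n then -g (-i) else i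
  have f1 : ∀ i : ℤ, 1 ≤ i → i ≤ n → f i = g i := fun i h1 h2 => if_pos ⟨h1, h2⟩
  have f2 : ∀ i : ℤ, 1 ≤ -i → -i ≤ n → f i = - g (-i) := fun i h1 h2 => by
    simp only [f]
    rw [if_neg (by omega), if_pos ⟨h1, h2⟩]
  have f3 : ∀ i : ℤ, i = 0 ∨ n < i.natAbs → f i = i := fun i h1 => by
    simp only [f]
    rw [if_neg (by omega), if_neg (by omega)]
  have tri : ∀ i : ℤ, (1 ≤ i ∧ i ≤ n) ∨ (1 ≤ -i ∧ -i ≤ n) ∨ (i = 0 ∨ n < i.natAbs) := by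
    intro i; omega
  have hfi : Function.Injective f := by
    intro i j e
    rcases tri i with hi | hi | hi <;> rcases tri j with hj | hj | hj
    · rw [f1 i hi.1 hi.2, f1 j hj.1 hj.2] at e
      exact hinj i j hi.1 hi.2 hj.1 hj.2 (by rw [e])
    · rw [f1 i hi.1 hi.2, f2 j hj.1 hj.2] at e
      have := hinj i (-j) hi.1 hi.2 hj.1 hj.2 (by omega)
      subst this
      have := hb _ hj.1 hj.2
      omega
    · rw [f1 i hi.1 hi.2, f3 j hj] at e
      have := hb _ hi.1 hi.2
      omega
    · rw [f2 i hi.1 hi.2, f1 j hj.1 hj.2] at e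
      have := hinj (-i) j hi.1 hi.2 hj.1 hj.2 (by omega)
      subst this
      have := hb _ hi.1 hi.2
      omega
    · rw [f2 i hi.1 hi.2, f2 j hj.1 hj.2] at e
      have := hinj (-i) (-j) hi.1 hi.2 hj.1 hj.2 (by omega)
      omega
    · rw [f2 i hi.1 hi.2, f3 j hj] at e
      have := hb _ hi.1 hi.2
      omega
    · rw [f3 i hi, f1 j hj.1 hj.2] at e
      have := hb _ hj.1 hj.2
      omega
    · rw [f3 i hi, f2 j hj.1 hj.2] at e
      have := hb _ hj.1 hj.2
      omega
    · rw [f3 i hi, f3 j hj] at e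
      exact e
  have hfs : Function.Surjective f := by
    intro y
    by_cases hy : y = 0 ∨ n < y.natAbs
    · exact ⟨y, f3 y hy⟩
    · obtain ⟨i, h1, h2, h3⟩ := hsur y.natAbs (by omega) (by omega)
      rcases Int.natAbs_eq_natAbs_iff.1 h3 with e | e
      · exact ⟨i, by rw [f1 i h1 h2, e]⟩
      · exact ⟨-i, by rw [f2 (-i) (by omega) (by omega), neg_neg, e, neg_neg]⟩
  refine ⟨Equiv.ofBijective f ⟨hfi, hfs⟩, ⟨?_, ?_⟩, ?_⟩
  · intro i
    change f (-i) = - f i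
    rcases tri i with hi | hi | hi
    · rw [f1 i hi.1 hi.2, f2 (-i) (by omega) (by omega), neg_neg]
    · rw [f2 i hi.1 hi.2, f1 (-i) hi.1 hi.2, neg_neg]
    · rw [f3 i hi, f3 (-i) (by omega)]
  · intro i hi
    rw [Int.abs_eq_natAbs] at hi
    exact f3 i (Or.inr (by omega))
  · refine win_congr.2 ?_
    intro i h1 h2
    exact f1 i h1 h2

lemma win_inj {n : ℕ} {w w' : Equiv.Perm ℤ} (h : IsBn n w) (h' : IsBn n w')
    (e : win w n = win w' n) : w = w' := by
  have e := win_congr.1 e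
  ext i
  rcases (by omega : (1 ≤ i ∧ i ≤ n) ∨ (1 ≤ -i ∧ -i ≤ n) ∨ i = 0 ∨ n < i.natAbs) with
    hi | hi | hi | hi
  · exact e i hi.1 hi.2
  · have h1 := e (-i) hi.1 hi.2
    rw [h.1, h'.1] at h1
    omega
  · subst hi
    have a := h.1 0
    have b := h'.1 0
    simp only [neg_zero] at a b
    omega
  · have hi' : (n : ℤ) < |i| := by rw [Int.abs_eq_natAbs]; omega
    rw [h.2 i hi', h'.2 i hi']

lemma card_eq (n : ℕ) :
    Nat.card {w : Equiv.Perm ℤ // IsBn n w ∧ AvoidsFive n w} = (SS n).card := by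
  rw [← Nat.card_eq_finsetCard (SS n)]
  refine Nat.card_congr (Equiv.ofBijective
    (fun w => ⟨win w.1 n, mem_SS.2 ⟨win_perm w.2.1, avoids_iff.1 w.2.2⟩⟩) ⟨?_, ?_⟩)
  · rintro ⟨w, hw⟩ ⟨w', hw'⟩ e
    exact Subtype.ext (win_inj hw.1 hw'.1 (Subtype.mk.inj e))
  · rintro ⟨r, hr⟩
    have hr' := mem_SS.1 hr
    obtain ⟨w, hw, e⟩ := win_surj hr'.1
    exact ⟨⟨w, hw, avoids_iff.2 (by rw [e]; exact hr'.2)⟩, Subtype.ext e⟩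

end Five

/-- The number of elements of `B_n` whose window avoids the five signed
patterns `1 2̄`, `2̄ 1`, `2̄ 1̄`, `3 1 2`, `3 1̄ 2` equals the Catalan number
`(1/(n+2)) * C(2n+2, n+1)`. -/
theorem stmt_4 (n : ℕ) (hn : 1 ≤ n) :
    Nat.card {w : Equiv.Perm ℤ // IsBn n w ∧ AvoidsFive n w} * (n + 2)
      = Nat.choose (2 * n + 2) (n + 1) := by
  rw [Five.card_eq, Five.card_SS]
  exact Five.TT_catalan n
end

section
/- For every n ≥ 1, the number of elements w ∈ B_n whose long one-line notation avoids both patterns 3412 and 4231 equals the number of permutations u of {1,…,n+1} whose one-line notation (u(1),…,u(n+1)) avoids both patterns 3412 and 4231. -/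
open scoped BigOperators

/-- The one-line notation `(u 0, …, u n)` of a permutation of `Fin (n+1)` avoids `3412`. -/
def FinAvoids3412 {m : ℕ} (u : Equiv.Perm (Fin m)) : Prop :=
  ¬ ∃ i1 i2 i3 i4 : Fin m, i1 < i2 ∧ i2 < i3 ∧ i3 < i4 ∧
    u i3 < u i4 ∧ u i4 < u i1 ∧ u i1 < u i2

/-- The one-line notation `(u 0, …, u n)` of a permutation of `Fin (n+1)` avoids `4231`. -/
def FinAvoids4231 {m : ℕ} (u : Equiv.Perm (Fin m)) : Prop :=
  ¬ ∃ i1 i2 i3 i4 : Fin m, i1 < i2 ∧ i2 < i3 ∧ i3 < i4 ∧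
    u i4 < u i2 ∧ u i2 < u i3 ∧ u i3 < u i1


namespace SmoothCount

open Equiv

/-- `w` avoids 3412 and 4231 on all of `ℤ`. -/
def Smooth (w : Perm ℤ) : Prop :=
  ∀ a b c d : ℤ, a < b → b < c → c < d →
    ¬ (w c < w d ∧ w d < w a ∧ w a < w b) ∧ ¬ (w d < w b ∧ w b < w c ∧ w c < w a)

/-- `w` is strictly decreasing on `[a,b]`. -/
def DecOn (w : Perm ℤ) (a b : ℤ) : Prop := ∀ i j : ℤ, a ≤ i → i < j → j ≤ b → w j < w i

/-- The entries from the maximal value `n` on are decreasing. -/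
def InA (n : ℕ) (w : Perm ℤ) : Prop := DecOn w (w⁻¹ (n : ℤ)) n

open Classical in
/-- Length of the maximal decreasing suffix of the window `[0,n]`. -/
noncomputable def R (n : ℕ) (w : Perm ℤ) : ℕ :=
  Nat.findGreatest (fun k : ℕ => DecOn w ((n : ℤ) + 1 - k) n) (n + 1)

/-- Labels of the generating tree. -/
abbrev Lab := ℕ × ℕ × Prop × Prop

noncomputable def lab (n : ℕ) (w : Perm ℤ) : Lab := (R n w, R n w⁻¹, InA n w, InA n w⁻¹)

def swapLab (l : Lab) : Lab := (l.2.1, l.1, l.2.2.2, l.2.2.1)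

open Classical in
noncomputable def child (l : Lab) (j : ℕ) : Lab :=
  (j + 1, if l.2.2.1 ∧ j = l.1 then l.2.1 + 1 else 1, True,
    j = 0 ∨ (l.2.2.1 ∧ l.2.2.2 ∧ j = l.1))

open Classical in
noncomputable def mask (f : Lab → ℕ) (l : Lab) : ℕ := if l.2.2.1 then 0 else f l

noncomputable def step (f : Lab → ℕ) (l : Lab) : ℕ :=
  (∑ j ∈ Finset.range (l.1 + 1), f (child l j)) +
    ∑ j ∈ Finset.range (l.2.1 + 1), mask f (swapLab (child (swapLab l) j))

noncomputable def desc : ℕ → Lab → ℕ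
  | 0 => fun _ => 1
  | k + 1 => step (desc k)

theorem lab_inv (n : ℕ) (w : Perm ℤ) : lab n w⁻¹ = swapLab (lab n w) := by
  simp [lab, swapLab]

theorem swap_swap (l : Lab) : swapLab (swapLab l) = l := rfl

open Classical in
theorem count_step (X Y : Finset (Perm ℤ)) (n : ℕ)
    (hX : ∀ w ∈ X, w⁻¹ ∈ X) (hY : ∀ w ∈ Y, w⁻¹ ∈ Y)
    (hA : ∀ w ∈ Y, InA (n + 1) w ∨ InA (n + 1) w⁻¹)
    (hins : ∀ f : Lab → ℕ, ∑ w ∈ Y with InA (n + 1) w, f (lab (n + 1) w) =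
      ∑ w ∈ X, ∑ j ∈ Finset.range (R n w + 1), f (child (lab n w) j)) (f : Lab → ℕ) :
    ∑ w ∈ Y, f (lab (n + 1) w) = ∑ w ∈ X, step f (lab n w) := by
  have h1 : ∑ w ∈ Y, f (lab (n + 1) w) = ∑ w ∈ Y with InA (n + 1) w, f (lab (n + 1) w)
      + ∑ w ∈ Y with InA (n + 1) w⁻¹, mask f (lab (n + 1) w) := by
    rw [Finset.sum_filter, Finset.sum_filter, ← Finset.sum_add_distrib]
    refine Finset.sum_congr rfl fun w hw => ?_
    have := hA w hw
    by_cases h : InA (n + 1) w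
    · simp [h, mask, lab]
    · have h' : InA (n + 1) w⁻¹ := by tauto
      simp [h, h', mask, lab]
  have h2 : ∑ w ∈ Y with InA (n + 1) w⁻¹, mask f (lab (n + 1) w)
      = ∑ w ∈ Y with InA (n + 1) w, mask f (swapLab (lab (n + 1) w)) := by
    refine Finset.sum_nbij' (fun w => w⁻¹) (fun w => w⁻¹) ?_ ?_ ?_ ?_ ?_
    · intro w hw
      simp only [Finset.mem_filter] at hw ⊢
      exact ⟨hY w hw.1, hw.2⟩
    · intro w hw
      simp only [Finset.mem_filter] at hw ⊢
      exact ⟨hY w hw.1, by simpa using hw.2⟩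
    · intro w _; simp
    · intro w _; simp
    · intro w _; rw [lab_inv, swap_swap]
  have h3 : ∑ w ∈ X, ∑ j ∈ Finset.range (R n w + 1), mask f (swapLab (child (lab n w) j))
      = ∑ w ∈ X, ∑ j ∈ Finset.range (R n w⁻¹ + 1),
          mask f (swapLab (child (swapLab (lab n w)) j)) := by
    refine Finset.sum_nbij' (fun w => w⁻¹) (fun w => w⁻¹) ?_ ?_ ?_ ?_ ?_
    · intro w hw; exact hX w hw
    · intro w hw; exact hX w hw
    · intro w _; simp
    · intro w _; simp
    · intro w _; rw [lab_inv, swap_swap, inv_inv]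
  rw [h1, h2, hins f, hins (fun l => mask f (swapLab l)), h3, ← Finset.sum_add_distrib]
  rfl

open Classical in
theorem count_main (X : ℕ → Finset (Perm ℤ)) (h0 : X 0 = {1})
    (hinv : ∀ n, ∀ w ∈ X n, w⁻¹ ∈ X n)
    (hA : ∀ n, ∀ w ∈ X (n + 1), InA (n + 1) w ∨ InA (n + 1) w⁻¹)
    (hins : ∀ n, ∀ f : Lab → ℕ, ∑ w ∈ X (n + 1) with InA (n + 1) w, f (lab (n + 1) w) =
      ∑ w ∈ X n, ∑ j ∈ Finset.range (R n w + 1), f (child (lab n w) j)) (n : ℕ) :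
    (X n).card = desc n (lab 0 1) := by
  have key : ∀ n k, ∑ w ∈ X n, desc k (lab n w) = desc (n + k) (lab 0 1) := by
    intro n
    induction n with
    | zero => intro k; simp [h0]
    | succ n ih =>
      intro k
      rw [count_step (X n) (X (n + 1)) n (hinv n) (hinv (n + 1)) (hA n) (hins n) (desc k)]
      have := ih (k + 1)
      rw [show n + 1 + k = n + (k + 1) by omega, ← this]
      rfl
  have := key n 0
  simpa [desc] using this

theorem Smooth.inv {w : Perm ℤ} (h : Smooth w) : Smooth w⁻¹ := by
  intro a b c d hab hbc hcd
  constructor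
  · rintro ⟨h1, h2, h3⟩
    refine (h _ _ _ _ h1 h2 h3).1 ?_
    simp [*]
  · rintro ⟨h1, h2, h3⟩
    refine (h _ _ _ _ h1 h2 h3).2 ?_
    simp [*]

theorem fix_le {w : Perm ℤ} {N : ℤ} (h : ∀ i, N < i → w i = i) {i : ℤ} (hi : i ≤ N) : w i ≤ N := by
  by_contra hc
  have h1 := h (w i) (by omega)
  have := w.injective h1
  omega

theorem fix_inv {w : Perm ℤ} {i : ℤ} (h : w i = i) : w⁻¹ i = i := by
  rw [Perm.inv_eq_iff_eq]; exact h.symm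

theorem occ_le {w : Perm ℤ} {N : ℤ} (h : ∀ i, N < i → w i = i) {a b c d : ℤ} (_ : a < b)
    (_ : b < c) (_ : c < d) (ho : (w c < w d ∧ w d < w a ∧ w a < w b) ∨
      (w d < w b ∧ w b < w c ∧ w c < w a)) : d ≤ N := by
  by_contra hd
  have h1 := h d (by omega)
  by_cases ha : a ≤ N
  · have := fix_le h ha
    omega
  · have := h a (by omega)
    omega

/-- Gasharov's dichotomy. -/
theorem dichotomy {w : Perm ℤ} {n : ℕ} (h : ∀ i, (n : ℤ) < i → w i = i) (hs : Smooth w) :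
    InA n w ∨ InA n w⁻¹ := by
  by_contra hc
  rw [not_or] at hc
  obtain ⟨h1, h2⟩ := hc
  unfold InA DecOn at h1 h2
  push Not at h1 h2
  rw [inv_inv] at h2
  obtain ⟨i, j, hi, hij, hj, hw⟩ := h1
  obtain ⟨p, q, hp, hpq, hq, hw'⟩ := h2
  have hwd : w (w⁻¹ (n : ℤ)) = n := by simp
  have h' : ∀ i, (n : ℤ) < i → w⁻¹ i = i := fun i hi => fix_inv (h i hi)
  set d := w⁻¹ (n : ℤ) with hd
  set e := w (n : ℤ) with he
  have hwe : w⁻¹ e = n := by simp [he]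
  have ne : ∀ x y, x ≠ y → w x ≠ w y := fun x y hxy hh => hxy (w.injective hh)
  have ne' : ∀ x y, x ≠ y → w⁻¹ x ≠ w⁻¹ y := fun x y hxy hh => hxy (w⁻¹.injective hh)
  have hdi : d < i := by
    rcases hi.lt_or_eq with h3 | h3
    · exact h3
    · have := fix_le h hj
      have := ne i j (by omega)
      subst h3
      omega
  have hep : e < p := by
    rcases hp.lt_or_eq with h3 | h3
    · exact h3
    · have := fix_le h' hq
      have := ne' p q (by omega)
      subst h3
      omega
  have hie : w i < e := by
    by_contra hcc
    have h3 := ne i n (by omega)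
    have h4 : j < n := by
      rcases hj.lt_or_eq with h5 | h5
      · exact h5
      · subst h5; omega
    have h6 := fix_le h hj
    have h7 := ne j d (by omega)
    have h8 := ne i j (by omega)
    exact (hs d i j n hdi hij h4).2 (by omega)
  have hpd : w⁻¹ p < d := by
    by_contra hcc
    have h3 := ne' p n (by omega)
    have h4 : q < n := by
      rcases hq.lt_or_eq with h5 | h5
      · exact h5
      · subst h5; omega
    have h6 := fix_le h' hq
    have h7 := ne' q e (by omega)
    have h8 := ne' p q (by omega)
    exact (hs.inv e p q n hep hpq h4).2 (by omega)
  refine (hs (w⁻¹ p) d i n hpd hdi (by omega)).1 ?_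
  have h9 : w (w⁻¹ p) = p := by simp
  rw [h9]
  omega

open Classical in
theorem R_le (n : ℕ) (w : Perm ℤ) : R n w ≤ n + 1 := Nat.findGreatest_le _

theorem DecOn.mono {w : Perm ℤ} {a a' b : ℤ} (h : DecOn w a b) (haa : a ≤ a') : DecOn w a' b :=
  fun i j hi hij hj => h i j (by omega) hij hj

theorem le_R_iff {n : ℕ} {w : Perm ℤ} {j : ℕ} (hj : j ≤ n + 1) :
    j ≤ R n w ↔ DecOn w ((n : ℤ) + 1 - j) n := by
  classical
  constructor
  · intro h
    have h0 : DecOn w ((n : ℤ) + 1 - (R n w : ℕ)) n := by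
      refine Nat.findGreatest_spec (P := fun k : ℕ => DecOn w ((n : ℤ) + 1 - k) n)
        (m := 0) (Nat.zero_le _) ?_
      intro a b; intros; push_cast at *; omega
    exact h0.mono (by omega)
  · intro h
    exact Nat.le_findGreatest hj h

theorem R_eq {n : ℕ} {w : Perm ℤ} {j : ℕ} (hj : j ≤ n + 1) (h : DecOn w ((n : ℤ) + 1 - j) n)
    (h' : j < n + 1 → ¬ DecOn w ((n : ℤ) - j) n) : R n w = j := by
  have h1 := (le_R_iff hj).2 h
  have h2 := R_le n w
  by_contra hne
  have h3 : j + 1 ≤ R n w := by omega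
  rw [le_R_iff (by omega)] at h3
  exact h' (by omega) (h3.mono (by push_cast; omega))

theorem label_child {n j : ℕ} {w v s : Perm ℤ} {d : ℤ} (hvs : ∀ x, v (s x) = w x)
    (hj : j ≤ R n w) (hd : d = (n : ℤ) + 1 - j) (hsn : s ((n : ℤ) + 1) = d)
    (hlt : ∀ x : ℤ, 0 ≤ x → x < d → x ≤ n → s x = x)
    (hge : ∀ x : ℤ, 0 ≤ x → d ≤ x → x ≤ n → s x = x + 1)
    (hmono : ∀ x y : ℤ, -(n : ℤ) ≤ x → x < y → y ≤ n → s x < s y)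
    (hw : ∀ x : ℤ, -(n : ℤ) ≤ x → x ≤ n → -(n : ℤ) ≤ w x ∧ w x ≤ n)
    (hw' : ∀ x : ℤ, -(n : ℤ) ≤ x → x ≤ n → -(n : ℤ) ≤ w⁻¹ x ∧ w⁻¹ x ≤ n)
    (hwn : w ((n : ℤ) + 1) = n + 1) (h0 : d = 0 → 0 ≤ w⁻¹ (n : ℤ)) :
    lab (n + 1) v = child (lab n w) j := by
  classical
  have hjn := hj.trans (R_le n w)
  have hdec := (le_R_iff hjn).1 hj
  rw [← hd] at hdec
  have hd0 : 0 ≤ d := by omega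
  have hvd : v d = n + 1 := by rw [← hsn, hvs, hwn]
  have hvi : ∀ x, v⁻¹ x = s (w⁻¹ x) := by
    intro x; rw [Perm.inv_eq_iff_eq, hvs]; simp
  have hvid : v⁻¹ ((n : ℤ) + 1) = d := by rw [Perm.inv_eq_iff_eq, hvd]
  have hdecv : DecOn v d (n + 1) := by
    intro x y hx hxy hy
    have hy' : v y = w (y - 1) := by
      rw [← hvs, hge (y - 1) (by omega) (by omega) (by omega)]; congr 1; omega
    rcases hx.lt_or_eq with h | h
    · have hx' : v x = w (x - 1) := by
        rw [← hvs, hge (x - 1) (by omega) (by omega) (by omega)]; congr 1; omega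
      rw [hx', hy']
      exact hdec _ _ (by omega) (by omega) (by omega)
    · rw [← h, hvd, hy']
      have := hw (y - 1) (by omega) (by omega)
      omega
  have hR : R (n + 1) v = j + 1 := by
    refine R_eq (by omega) (hdecv.mono (by push_cast; omega)) ?_
    intro hlt' hD
    have h1 := hD (d - 1) d (by push_cast; omega) (by omega) (by push_cast; omega)
    have h2 : v (d - 1) = w (d - 1) := by
      rw [← hvs (d - 1), hlt (d - 1) (by omega) (by omega) (by omega)]
    have := hw (d - 1) (by omega) (by omega)
    omega
  have hAv : InA (n + 1) v := by
    unfold InA; push_cast; rw [hvid]; exact hdecv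
  have hnn := hw' n (by omega) (by omega)
  have hgt : ∀ y : ℤ, -(n : ℤ) ≤ y → y ≤ n → (d < s y ↔ d ≤ y) := by
    intro y hy1 hy2
    constructor
    · intro h
      by_contra hc
      rcases lt_or_ge y 0 with hy | hy
      · have h1 := hmono y 0 hy1 hy (by omega)
        rcases hd0.lt_or_eq with h2 | h2
        · have := hlt 0 le_rfl h2 (by omega); omega
        · have := hge 0 le_rfl (by omega) (by omega); omega
      · have := hlt y hy (by omega) hy2; omega
    · intro h
      have := hge y (by omega) h hy2; omega
  have hdecinv : ∀ e : ℤ, -(n : ℤ) ≤ e → e ≤ n →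
      (DecOn v⁻¹ e (n + 1) ↔ d ≤ w⁻¹ (n : ℤ) ∧ DecOn w⁻¹ e n) := by
    intro e he1 he2
    constructor
    · intro h
      refine ⟨?_, ?_⟩
      · have := h n (n + 1) he2 (by omega) le_rfl
        rw [hvid, hvi, hgt _ hnn.1 hnn.2] at this
        exact this
      · intro x y hx hxy hy
        have := h x y hx hxy (by omega)
        rw [hvi, hvi] at this
        by_contra hc
        have hx' := hw' x (by omega) (by omega)
        have hy' := hw' y (by omega) (by omega)
        rcases (not_lt.1 hc).lt_or_eq with h3 | h3
        · have := hmono _ _ hx'.1 h3 hy'.2; omega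
        · rw [h3] at this; omega
    · rintro ⟨h1, h2⟩ x y hx hxy hy
      have hx' := hw' x (by omega) (by omega)
      rcases hy.lt_or_eq with h3 | h3
      · rw [hvi, hvi]
        have hy' := hw' y (by omega) (by omega)
        exact hmono _ _ hy'.1 (h2 x y hx hxy (by omega)) hx'.2
      · subst h3
        rw [hvid, hvi, hgt _ hx'.1 hx'.2]
        rcases (show x ≤ n by omega).lt_or_eq with h4 | h4
        · have := h2 x n hx h4 le_rfl; omega
        · rw [h4]; exact h1
  have hcond : (InA n w ∧ j = R n w) ↔ d ≤ w⁻¹ (n : ℤ) := by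
    constructor
    · rintro ⟨h1, h2⟩
      by_cases h3 : 0 ≤ w⁻¹ (n : ℤ)
      · obtain ⟨k, hk⟩ := Int.eq_ofNat_of_zero_le (show 0 ≤ (n : ℤ) + 1 - w⁻¹ (n : ℤ) by omega)
        have : k ≤ R n w := (le_R_iff (by omega)).2 (by
          unfold InA at h1; exact h1.mono (by omega))
        omega
      · have : n + 1 ≤ R n w := (le_R_iff (by omega)).2 (by
          unfold InA at h1; exact h1.mono (by push_cast; omega))
        have := h0 (by omega)
        omega
    · intro h
      have h1 : w⁻¹ (n : ℤ) = d := by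
        rcases h.lt_or_eq with h2 | h2
        · have h3 := hdec d _ le_rfl h2 hnn.2
          have := hw d (by omega) (by omega)
          simp at h3
          omega
        · exact h2.symm
      refine ⟨by unfold InA; rw [h1]; exact hdec, ?_⟩
      by_contra hne
      have h3 : j + 1 ≤ R n w := by omega
      have h4 := R_le n w
      rw [le_R_iff (by omega)] at h3
      have h5 := h3 (d - 1) d (by push_cast; omega) (by omega) (by omega)
      have := hw (d - 1) (by omega) (by omega)
      have h6 : w d = n := by rw [← h1]; simp
      omega
  have hR' : R (n + 1) v⁻¹ = if InA n w ∧ j = R n w then R n w⁻¹ + 1 else 1 := by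
    split_ifs with h
    · rw [hcond] at h
      have h4 := R_le n w⁻¹
      refine R_eq (by omega) ?_ ?_
      · have h5 := (le_R_iff h4).1 (le_refl (R n w⁻¹))
        rcases Nat.eq_zero_or_pos (R n w⁻¹) with h6 | h6
        · intro x y _ _ _; push_cast at *; omega
        · have := (hdecinv (n + 1 - (R n w⁻¹ : ℕ)) (by omega) (by omega)).2 ⟨h, h5⟩
          push_cast
          exact this.mono (by omega)
      · intro h5 h6
        push_cast at h6
        have h7 := ((hdecinv (n - (R n w⁻¹ : ℕ)) (by omega) (by omega)).1
          (h6.mono (by omega))).2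
        have : R n w⁻¹ + 1 ≤ R n w⁻¹ := (le_R_iff (by omega)).2 (h7.mono (by push_cast; omega))
        omega
    · rw [hcond] at h
      refine R_eq (by omega) ?_ ?_
      · intro x y _ _ _; push_cast at *; omega
      · intro h5 h6
        push_cast at h6
        exact h ((hdecinv n (by omega) (by omega)).1 (h6.mono (by omega))).1
  have hA' : InA (n + 1) v⁻¹ ↔ j = 0 ∨ (InA n w ∧ InA n w⁻¹ ∧ j = R n w) := by
    have hx : InA (n + 1) v⁻¹ ↔ DecOn v⁻¹ (v (n + 1)) (n + 1) := by
      unfold InA; rw [inv_inv]; push_cast; rfl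
    have hy : InA n w⁻¹ ↔ DecOn w⁻¹ (w n) n := by
      unfold InA; rw [inv_inv]
    rw [hx, hy]
    by_cases hj0 : j = 0
    · simp only [hj0, true_or, iff_true]
      have : (n : ℤ) + 1 = d := by omega
      rw [this, hvd]
      intro x y _ _ _; omega
    · have h1 : v (n + 1) = w n := by
        rw [← hge n (by omega) (by omega) le_rfl, hvs]
      have h2 := hw n (by omega) (by omega)
      rw [h1, hdecinv _ h2.1 h2.2, ← hcond]
      tauto
  unfold lab child
  simp only [hR, hR', hA', hAv]

theorem smooth_of_embed {v w t : Perm ℤ} (P : ℤ → Prop) (hvw : ∀ x, v x = w (t x))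
    (hw : Smooth w) (hmono : ∀ x y, P x → P y → x < y → t x < t y)
    (hocc : ∀ a b c d : ℤ, a < b → b < c → c < d → ((v c < v d ∧ v d < v a ∧ v a < v b) ∨
      (v d < v b ∧ v b < v c ∧ v c < v a)) → P a ∧ P b ∧ P c ∧ P d) : Smooth v := by
  intro a b c d hab hbc hcd
  rw [← not_or]
  intro h
  obtain ⟨pa, pb, pc, pd⟩ := hocc a b c d hab hbc hcd h
  have := hw _ _ _ _ (hmono a b pa pb hab) (hmono b c pb pc hbc) (hmono c d pc pd hcd)
  rw [← not_or] at this
  simp only [hvw] at h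
  exact this h

theorem mono_inv {s : Perm ℤ} {P : ℤ → Prop} (h : ∀ x y, P x → P y → x < y → s x < s y) :
    ∀ x y, P (s⁻¹ x) → P (s⁻¹ y) → x < y → s⁻¹ x < s⁻¹ y := by
  intro x y hx hy hxy
  by_contra hc
  rcases (not_lt.1 hc).lt_or_eq with h1 | h1
  · have := h _ _ hy hx h1
    simp at this; omega
  · have := s⁻¹.injective h1
    omega

theorem no_use {v : Perm ℤ} {N p : ℤ} (h : ∀ i, N < i → v i = i) (hp : v p = N)
    (hdec : DecOn v p N) {a b c d : ℤ} (hab : a < b) (hbc : b < c) (hcd : c < d)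
    (ho : (v c < v d ∧ v d < v a ∧ v a < v b) ∨
      (v d < v b ∧ v b < v c ∧ v c < v a)) : a ≠ p ∧ b ≠ p ∧ c ≠ p ∧ d ≠ p := by
  have hd := occ_le h hab hbc hcd ho
  have ha := fix_le h (show a ≤ N by omega)
  have hb := fix_le h (show b ≤ N by omega)
  refine ⟨?_, ?_, ?_, ?_⟩
  · rintro rfl
    have := hdec b c hab.le hbc (by omega)
    omega
  · rintro rfl
    have := hdec c d hbc.le hcd (by omega)
    omega
  · rintro rfl
    omega
  · rintro rfl
    omega

theorem occ_neg {v : Perm ℤ} (hv : ∀ i, v (-i) = - v i) {a b c d : ℤ}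
    (ho : (v c < v d ∧ v d < v a ∧ v a < v b) ∨ (v d < v b ∧ v b < v c ∧ v c < v a)) :
    (v (-b) < v (-a) ∧ v (-a) < v (-d) ∧ v (-d) < v (-c)) ∨
      (v (-a) < v (-c) ∧ v (-c) < v (-b) ∧ v (-b) < v (-d)) := by
  simp only [hv]; omega

/-- The cycle used for inserting the new maximal value. -/
def sS (n j : ℕ) : Perm ℤ where
  toFun x := if x = (n : ℤ) + 1 then (n : ℤ) + 1 - j else
    if (n : ℤ) + 1 - j ≤ x ∧ x ≤ n then x + 1 else x
  invFun x := if x = (n : ℤ) + 1 - j then (n : ℤ) + 1 else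
    if (n : ℤ) + 1 - j < x ∧ x ≤ n + 1 then x - 1 else x
  left_inv x := by
    dsimp only
    split_ifs <;> omega
  right_inv x := by
    dsimp only
    split_ifs <;> omega

theorem sS_apply (n j : ℕ) (x : ℤ) :
    sS n j x = if x = (n : ℤ) + 1 then (n : ℤ) + 1 - j else
    if (n : ℤ) + 1 - j ≤ x ∧ x ≤ n then x + 1 else x := rfl

def InS (n : ℕ) (w : Perm ℤ) : Prop := (∀ i : ℤ, i < 0 ∨ (n : ℤ) < i → w i = i) ∧ Smooth w

def InB (n : ℕ) (w : Perm ℤ) : Prop := IsBn n w ∧ Smooth w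

theorem finite_supp (n : ℕ) :
    {w : Perm ℤ | ∀ i : ℤ, ¬ (-(n : ℤ) ≤ i ∧ i ≤ n) → w i = i}.Finite := by
  have e := Perm.subtypeEquivSubtypePerm (fun i : ℤ => -(n : ℤ) ≤ i ∧ i ≤ n)
  have : Finite {i : ℤ // -(n : ℤ) ≤ i ∧ i ≤ n} := Set.finite_Icc (-(n : ℤ)) n
  exact Finite.of_equiv _ e

theorem finite_S (n : ℕ) : {w | InS n w}.Finite :=
  (finite_supp n).subset fun _ hw i hi => hw.1 i (by omega)

theorem finite_B (n : ℕ) : {w | InB n w}.Finite := by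
  refine (finite_supp n).subset fun w hw i hi => hw.1.2 i ?_
  rw [lt_abs]; omega

noncomputable def XS (n : ℕ) : Finset (Perm ℤ) := (finite_S n).toFinset
noncomputable def XB (n : ℕ) : Finset (Perm ℤ) := (finite_B n).toFinset

theorem mem_XS {n : ℕ} {w : Perm ℤ} : w ∈ XS n ↔ InS n w := by simp [XS]
theorem mem_XB {n : ℕ} {w : Perm ℤ} : w ∈ XB n ↔ InB n w := by simp [XB]

theorem smooth_one : Smooth 1 := by
  intro a b c d _ _ _
  simp only [Perm.one_apply]
  omega

theorem XS_zero : XS 0 = {1} := by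
  ext w
  rw [mem_XS, Finset.mem_singleton]
  constructor
  · intro h
    ext x
    rw [Perm.one_apply]
    by_cases hx : x = 0
    · subst hx
      have h1 := fix_le (N := 0) (fun i hi => h.1 i (Or.inr hi)) le_rfl
      rcases h1.lt_or_eq with h2 | h2
      · have := w.injective (h.1 _ (Or.inl h2)); exact this
      · exact h2
    · exact h.1 x (by push_cast; omega)
  · rintro rfl
    exact ⟨fun _ _ => rfl, smooth_one⟩

theorem XB_zero : XB 0 = {1} := by
  ext w
  rw [mem_XB, Finset.mem_singleton]
  constructor
  · intro h
    ext x
    rw [Perm.one_apply]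
    by_cases hx : x = 0
    · subst hx
      have := h.1.1 0
      rw [neg_zero] at this
      omega
    · exact h.1.2 x (by push_cast; exact abs_pos.2 hx)
  · rintro rfl
    exact ⟨⟨fun _ => rfl, fun _ _ => rfl⟩, smooth_one⟩

theorem InS.inv {n : ℕ} {w : Perm ℤ} (h : InS n w) : InS n w⁻¹ :=
  ⟨fun i hi => fix_inv (h.1 i hi), h.2.inv⟩

theorem InB.inv {n : ℕ} {w : Perm ℤ} (h : InB n w) : InB n w⁻¹ :=
  ⟨⟨fun i => by rw [Perm.inv_eq_iff_eq, h.1.1]; simp, fun i hi => fix_inv (h.1.2 i hi)⟩, h.2.inv⟩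

theorem InS.fix {n : ℕ} {w : Perm ℤ} (h : InS n w) (i : ℤ) (hi : (n : ℤ) < i) : w i = i :=
  h.1 i (Or.inr hi)

theorem InB.fix {n : ℕ} {w : Perm ℤ} (h : InB n w) (i : ℤ) (hi : (n : ℤ) < i) : w i = i :=
  h.1.2 i (lt_of_lt_of_le hi (le_abs_self i))

theorem InS.nonneg {n : ℕ} {w : Perm ℤ} (h : InS n w) {x : ℤ} (hx : 0 ≤ x) : 0 ≤ w x := by
  by_contra hc
  have := w.injective (h.1 (w x) (Or.inl (by omega)))
  omega

theorem InS.bound {n : ℕ} {w : Perm ℤ} (h : InS n w) (x : ℤ) (h1 : -(n : ℤ) ≤ x) (h2 : x ≤ n) :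
    -(n : ℤ) ≤ w x ∧ w x ≤ n := by
  refine ⟨?_, fix_le h.fix h2⟩
  by_cases hx : 0 ≤ x
  · have := h.nonneg hx; omega
  · rw [h.1 x (by omega)]; exact h1

theorem InB.bound {n : ℕ} {w : Perm ℤ} (h : InB n w) (x : ℤ) (h1 : -(n : ℤ) ≤ x) (h2 : x ≤ n) :
    -(n : ℤ) ≤ w x ∧ w x ≤ n := by
  have := fix_le h.fix (show -x ≤ (n : ℤ) by omega)
  rw [h.1.1] at this
  exact ⟨by omega, fix_le h.fix h2⟩

theorem lab_S {n j : ℕ} {w v : Perm ℤ} (hw : InS n w) (hj : j ≤ R n w)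
    (hv : ∀ x, v (sS n j x) = w x) : lab (n + 1) v = child (lab n w) j := by
  have hjn := hj.trans (R_le n w)
  refine label_child (d := (n : ℤ) + 1 - j) hv hj rfl ?_ ?_ ?_ ?_ hw.bound hw.inv.bound
    (hw.fix _ (by omega)) (fun _ => hw.inv.nonneg (by omega))
  · rw [sS_apply, if_pos rfl]
  all_goals
    intros
    simp only [sS_apply]
    split_ifs <;> omega

/-- Decreasing suffix after insertion. -/
theorem dec_ins {n j : ℕ} {w v : Perm ℤ} (hle : ∀ x : ℤ, x ≤ n → w x ≤ n)
    (hd : DecOn w ((n : ℤ) + 1 - j) n)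
    (h1 : v ((n : ℤ) + 1 - j) = n + 1)
    (h2 : ∀ x : ℤ, (n : ℤ) + 1 - j ≤ x → x ≤ n → v (x + 1) = w x) :
    DecOn v ((n : ℤ) + 1 - j) (n + 1) := by
  intro x y hx hxy hy
  have hy' := h2 (y - 1) (by omega) (by omega)
  rw [sub_add_cancel] at hy'
  rcases hx.lt_or_eq with h | h
  · have hx' := h2 (x - 1) (by omega) (by omega)
    rw [sub_add_cancel] at hx'
    rw [hx', hy']
    exact hd _ _ (by omega) (by omega) (by omega)
  · rw [← h, h1, hy']
    have := hle (y - 1) (by omega)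
    omega

theorem dec_del {n j : ℕ} {w v : Perm ℤ}
    (hd : DecOn v ((n : ℤ) + 1 - j) (n + 1))
    (h2 : ∀ x : ℤ, (n : ℤ) + 1 - j ≤ x → x ≤ n → v (x + 1) = w x) :
    DecOn w ((n : ℤ) + 1 - j) n := by
  intro x y hx hxy hy
  rw [← h2 x (by omega) (by omega), ← h2 y (by omega) (by omega)]
  exact hd _ _ (by omega) (by omega) (by omega)

theorem sS_mono (n j : ℕ) (x y : ℤ) (hx : x ≠ n + 1) (hy : y ≠ n + 1) (h : x < y) :
    sS n j x < sS n j y := by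
  simp only [sS_apply]
  split_ifs <;> omega

theorem ins_S {n j : ℕ} {w v : Perm ℤ} (hw : InS n w) (hj : j ≤ R n w)
    (hv : ∀ x, v (sS n j x) = w x) :
    InS (n + 1) v ∧ v⁻¹ ((n + 1 : ℕ) : ℤ) = n + 1 - j ∧ InA (n + 1) v := by
  have hjn := hj.trans (R_le n w)
  have hdec := (le_R_iff hjn).1 hj
  have h1 : v ((n : ℤ) + 1 - j) = n + 1 := by
    have := hv (n + 1)
    rw [sS_apply, if_pos rfl, hw.fix _ (by omega)] at this
    exact this
  have h2 : ∀ x : ℤ, (n : ℤ) + 1 - j ≤ x → x ≤ n → v (x + 1) = w x := by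
    intro x hx hx'
    rw [← hv x, sS_apply, if_neg (by omega), if_pos ⟨hx, hx'⟩]
  have h3 : v⁻¹ ((n + 1 : ℕ) : ℤ) = n + 1 - j := by
    rw [Perm.inv_eq_iff_eq, h1]; push_cast; rfl
  have hdv := dec_ins (fun x hx => fix_le hw.fix hx) hdec h1 h2
  have hfix : ∀ i : ℤ, i < 0 ∨ ((n + 1 : ℕ) : ℤ) < i → v i = i := by
    intro i hi
    push_cast at hi
    have := hv i
    rw [sS_apply, if_neg (by omega), if_neg (by omega)] at this
    rw [this]; exact hw.1 i (by omega)
  refine ⟨⟨hfix, ?_⟩, h3, ?_⟩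
  · refine smooth_of_embed (t := (sS n j)⁻¹) (fun x => (sS n j)⁻¹ x ≠ n + 1) ?_ hw.2
      (mono_inv (P := fun x => x ≠ (n : ℤ) + 1) (sS_mono n j)) ?_
    · intro x; rw [← hv]; simp
    · intro a b c d hab hbc hcd ho
      have := no_use (N := n + 1) (fun i hi => hfix i (Or.inr (by push_cast; omega))) h1 hdv
        hab hbc hcd ho
      have h4 : ∀ x : ℤ, (sS n j)⁻¹ x ≠ n + 1 ↔ x ≠ n + 1 - j := by
        intro x
        rw [ne_eq, Perm.inv_eq_iff_eq, sS_apply, if_pos rfl]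
      simp only [h4]
      exact this
  · unfold InA
    rw [h3]; push_cast; exact hdv

theorem del_S {n : ℕ} {v : Perm ℤ} (hv : InS (n + 1) v) (hA : InA (n + 1) v) :
    ∃ w j, InS n w ∧ j ≤ R n w ∧ v = w * (sS n j)⁻¹ := by
  have hd0 := hv.inv.nonneg (x := ((n + 1 : ℕ) : ℤ)) (by omega)
  have hd1 := fix_le hv.inv.fix (i := ((n + 1 : ℕ) : ℤ)) le_rfl
  obtain ⟨j, hj⟩ := Int.eq_ofNat_of_zero_le
    (show 0 ≤ (n : ℤ) + 1 - v⁻¹ ((n + 1 : ℕ) : ℤ) by push_cast at *; omega)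
  have hd : v⁻¹ ((n + 1 : ℕ) : ℤ) = n + 1 - j := by omega
  have h1 : v ((n : ℤ) + 1 - j) = n + 1 := by
    rw [← hd]; simp
  unfold InA at hA
  rw [hd] at hA
  push_cast at hA
  have hfix : ∀ i : ℤ, i < 0 ∨ (n : ℤ) < i → (v * sS n j) i = i := by
    intro i hi
    rw [Perm.mul_apply, sS_apply]
    split_ifs with h3 h4
    · omega
    · omega
    · exact hv.1 i (by push_cast; omega)
  refine ⟨v * sS n j, j, ⟨hfix, ?_⟩, ?_, ?_⟩
  · refine smooth_of_embed (t := sS n j) (fun x => x ≠ (n : ℤ) + 1) (fun _ => rfl) hv.2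
      (sS_mono n j) ?_
    intro a b c d hab hbc hcd ho
    have := occ_le (fun i hi => hfix i (Or.inr hi)) hab hbc hcd ho
    refine ⟨?_, ?_, ?_, ?_⟩ <;> omega
  · rw [le_R_iff (by omega)]
    refine dec_del hA ?_
    intro x hx hx'
    rw [Perm.mul_apply, sS_apply, if_neg (by omega), if_pos ⟨hx, hx'⟩]
  · simp

open Classical in
theorem hins_S (n : ℕ) (f : Lab → ℕ) :
    ∑ w ∈ XS (n + 1) with InA (n + 1) w, f (lab (n + 1) w) =
      ∑ w ∈ XS n, ∑ j ∈ Finset.range (R n w + 1), f (child (lab n w) j) := by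
  rw [Finset.sum_sigma']
  symm
  have hvs : ∀ (w : Perm ℤ) (j : ℕ), ∀ x, (w * (sS n j)⁻¹) (sS n j x) = w x := by
    intro w j x; simp
  refine Finset.sum_bij (fun p _ => p.1 * (sS n p.2)⁻¹) ?_ ?_ ?_ ?_
  · rintro ⟨w, j⟩ h
    simp only [Finset.mem_sigma, Finset.mem_range, mem_XS, Finset.mem_filter] at h ⊢
    have := ins_S h.1 (by omega) (hvs w j)
    exact ⟨this.1, this.2.2⟩
  · rintro ⟨w, j⟩ h ⟨w', j'⟩ h' heq
    simp only [Finset.mem_sigma, Finset.mem_range, mem_XS] at h h' heq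
    have h1 := (ins_S h.1 (by omega) (hvs w j)).2.1
    have h2 := (ins_S h'.1 (by omega) (hvs w' j')).2.1
    rw [heq, h2] at h1
    have : j = j' := by omega
    subst this
    have := mul_right_cancel heq
    rw [this]
  · intro v hv
    simp only [Finset.mem_filter, mem_XS] at hv
    obtain ⟨w, j, hw, hj, rfl⟩ := del_S hv.1 hv.2
    refine ⟨⟨w, j⟩, ?_, rfl⟩
    simp only [Finset.mem_sigma, Finset.mem_range, mem_XS]
    exact ⟨hw, by omega⟩
  · rintro ⟨w, j⟩ h
    simp only [Finset.mem_sigma, Finset.mem_range, mem_XS] at h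
    simp only
    rw [lab_S h.1 (by omega) (hvs w j)]

theorem card_XS (n : ℕ) : (XS n).card = desc n (lab 0 1) := by
  refine count_main XS XS_zero ?_ ?_ hins_S n
  · intro n w hw
    rw [mem_XS] at *; exact hw.inv
  · intro n w hw
    rw [mem_XS] at hw
    exact dichotomy hw.fix hw.2

theorem occ_ge {w : Perm ℤ} {N : ℤ} (hodd : ∀ i, w (-i) = - w i) (h : ∀ i, N < i → w i = i)
    {a b c d : ℤ} (hab : a < b)
    (hbc : b < c) (hcd : c < d) (ho : (w c < w d ∧ w d < w a ∧ w a < w b) ∨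
      (w d < w b ∧ w b < w c ∧ w c < w a)) : -N ≤ a := by
  have := occ_le h (neg_lt_neg hcd) (neg_lt_neg hbc) (neg_lt_neg hab) (occ_neg hodd ho)
  omega

noncomputable def sB (n j : ℕ) : Perm ℤ :=
  if j = n + 1 then Equiv.swap ((n : ℤ) + 1) (-((n : ℤ) + 1))
  else sS n j * (Equiv.neg ℤ * sS n j * Equiv.neg ℤ)

theorem sB_apply {n j : ℕ} (h : j ≤ n) (x : ℤ) :
    sB n j x = if x = (n : ℤ) + 1 then (n : ℤ) + 1 - j else
      if x = -((n : ℤ) + 1) then -((n : ℤ) + 1 - j) else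
      if (n : ℤ) + 1 - j ≤ x ∧ x ≤ n then x + 1 else
      if -(n : ℤ) ≤ x ∧ x ≤ -((n : ℤ) + 1 - j) then x - 1 else x := by
  unfold sB
  rw [if_neg (by omega)]
  simp only [Perm.mul_apply, Equiv.neg_apply, sS_apply]
  split_ifs <;> omega

theorem sB_top (n : ℕ) (x : ℤ) :
    sB n (n + 1) x = if x = (n : ℤ) + 1 then -((n : ℤ) + 1) else
      if x = -((n : ℤ) + 1) then (n : ℤ) + 1 else x := by
  unfold sB
  rw [if_pos rfl, Equiv.swap_apply_def]

theorem sB_mono {n j : ℕ} (h : j ≤ n) (x y : ℤ) (hx : x ≠ (n : ℤ) + 1 ∧ x ≠ -((n : ℤ) + 1))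
    (hy : y ≠ (n : ℤ) + 1 ∧ y ≠ -((n : ℤ) + 1)) (hxy : x < y) :
    sB n j x < sB n j y := by
  simp only [sB_apply h]
  split_ifs <;> omega

theorem sB_odd {n j : ℕ} (h : j ≤ n) (x : ℤ) : sB n j (-x) = - sB n j x := by
  simp only [sB_apply h]
  split_ifs <;> omega

theorem lab_B {n j : ℕ} {w v : Perm ℤ} (hw : InB n w) (hj : j ≤ R n w) (hjn : j ≤ n)
    (hv : ∀ x, v (sB n j x) = w x) : lab (n + 1) v = child (lab n w) j := by
  refine label_child (d := (n : ℤ) + 1 - j) hv hj rfl ?_ ?_ ?_ ?_ hw.bound hw.inv.bound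
    (hw.fix _ (by omega)) (fun _ => by omega)
  · rw [sB_apply hjn, if_pos rfl]
  all_goals
    intros
    simp only [sB_apply hjn]
    split_ifs <;> omega

theorem ins_B {n j : ℕ} {w v : Perm ℤ} (hw : InB n w) (hj : j ≤ R n w) (hjn : j ≤ n)
    (hv : ∀ x, v (sB n j x) = w x) :
    InB (n + 1) v ∧ v⁻¹ ((n + 1 : ℕ) : ℤ) = n + 1 - j ∧ InA (n + 1) v := by
  have hdec := (le_R_iff (by omega)).1 hj
  have h1 : v ((n : ℤ) + 1 - j) = n + 1 := by
    have := hv (n + 1)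
    rw [sB_apply hjn, if_pos rfl, hw.fix _ (by omega)] at this
    exact this
  have h2 : ∀ x : ℤ, (n : ℤ) + 1 - j ≤ x → x ≤ n → v (x + 1) = w x := by
    intro x hx hx'
    rw [← hv x, sB_apply hjn, if_neg (by omega), if_neg (by omega), if_pos ⟨hx, hx'⟩]
  have h3 : v⁻¹ ((n + 1 : ℕ) : ℤ) = n + 1 - j := by
    rw [Perm.inv_eq_iff_eq, h1]; push_cast; rfl
  have hdv := dec_ins (fun x hx => fix_le hw.fix hx) hdec h1 h2
  have hodd : ∀ i : ℤ, v (-i) = - v i := by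
    intro i
    obtain ⟨x, rfl⟩ := (sB n j).surjective i
    rw [← sB_odd hjn, hv, hv, hw.1.1]
  have hfix : ∀ i : ℤ, ((n + 1 : ℕ) : ℤ) < |i| → v i = i := by
    intro i hi
    have hi0 := hi
    rw [lt_abs] at hi
    push_cast at hi
    have := hv i
    rw [sB_apply hjn, if_neg (by omega), if_neg (by omega), if_neg (by omega),
      if_neg (by omega)] at this
    rw [this]; exact hw.1.2 i (by push_cast at hi0; omega)
  refine ⟨⟨⟨hodd, hfix⟩, ?_⟩, h3, ?_⟩
  · refine smooth_of_embed (t := (sB n j)⁻¹)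
      (fun x => (sB n j)⁻¹ x ≠ (n : ℤ) + 1 ∧ (sB n j)⁻¹ x ≠ -((n : ℤ) + 1)) ?_ hw.2
      (mono_inv (P := fun x => x ≠ (n : ℤ) + 1 ∧ x ≠ -((n : ℤ) + 1)) (sB_mono hjn)) ?_
    · intro x; rw [← hv]; simp
    · intro a b c d hab hbc hcd ho
      have hf : ∀ i : ℤ, (n : ℤ) + 1 < i → v i = i := fun i hi =>
        hfix i (lt_abs.2 (Or.inl (by push_cast; omega)))
      have h5 := no_use hf h1 hdv hab hbc hcd ho
      have h6 := no_use hf h1 hdv (neg_lt_neg hcd) (neg_lt_neg hbc) (neg_lt_neg hab)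
        (occ_neg hodd ho)
      have h4 : ∀ x : ℤ, (sB n j)⁻¹ x ≠ (n : ℤ) + 1 ↔ x ≠ n + 1 - j := by
        intro x
        rw [ne_eq, Perm.inv_eq_iff_eq, sB_apply hjn, if_pos rfl]
      have h4' : ∀ x : ℤ, (sB n j)⁻¹ x ≠ -((n : ℤ) + 1) ↔ x ≠ -((n : ℤ) + 1 - j) := by
        intro x
        rw [ne_eq, Perm.inv_eq_iff_eq, sB_odd hjn, sB_apply hjn, if_pos rfl]
      simp only [h4, h4']
      omega
  · unfold InA
    rw [h3]; push_cast; exact hdv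

/-- `w` is the longest element on `[-n,n]`. -/
def IsW0 (n : ℕ) (w : Perm ℤ) : Prop := ∀ x : ℤ, -(n : ℤ) ≤ x → x ≤ n → w x = -x

theorem IsW0.inv {n : ℕ} {w : Perm ℤ} (h : IsW0 n w) : IsW0 n w⁻¹ := by
  intro x h1 h2
  rw [Perm.inv_eq_iff_eq, h (-x) (by omega) (by omega), neg_neg]

theorem IsW0.dec {n : ℕ} {w : Perm ℤ} (h : IsW0 n w) : DecOn w (-(n : ℤ)) n := by
  intro x y hx hxy hy
  rw [h x (by omega) (by omega), h y (by omega) (by omega)]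
  omega

theorem IsW0.inA {n : ℕ} {w : Perm ℤ} (h : IsW0 n w) : InA n w := by
  unfold InA
  rw [h.inv n (by omega) le_rfl]
  exact h.dec

theorem IsW0.R_eq {n : ℕ} {w : Perm ℤ} (h : IsW0 n w) : R n w = n + 1 := by
  refine SmoothCount.R_eq le_rfl (h.dec.mono (by push_cast; omega)) (by omega)

theorem IsW0.lab_eq {n : ℕ} {w : Perm ℤ} (h : IsW0 n w) :
    lab n w = (n + 1, n + 1, True, True) := by
  unfold lab
  simp [h.R_eq, h.inv.R_eq, h.inA, h.inv.inA]

theorem isW0_of_dec {n : ℕ} {w : Perm ℤ} (hw : InB n w) (hd : DecOn w 0 n) : IsW0 n w := by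
  have h0 : w 0 = 0 := by
    have := hw.1.1 0
    rw [neg_zero] at this
    omega
  have h1 : ∀ k : ℕ, k ≤ n → w (k : ℤ) ≤ -(k : ℤ) := by
    intro k
    induction k with
    | zero => intro _; simp [h0]
    | succ k ih =>
      intro hk
      have := ih (by omega)
      have := hd k (k + 1) (by omega) (by omega) (by omega)
      push_cast
      omega
  have h2 : ∀ k : ℕ, k ≤ n → -((n : ℤ) - k) ≤ w ((n : ℤ) - k) := by
    intro k
    induction k with
    | zero =>
      intro _
      have := hw.bound n (by omega) le_rfl
      simpa using this.1
    | succ k ih =>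
      intro hk
      have := ih (by omega)
      have := hd (n - (k + 1)) (n - k) (by omega) (by omega) (by omega)
      push_cast
      omega
  have h3 : ∀ x : ℤ, 0 ≤ x → x ≤ n → w x = -x := by
    intro x hx hx'
    obtain ⟨k, rfl⟩ := Int.eq_ofNat_of_zero_le hx
    have h4 := h1 k (by omega)
    have h5 := h2 (n - k) (by omega)
    rw [show (n : ℤ) - ((n - k : ℕ) : ℤ) = k by omega] at h5
    omega
  intro x hx hx'
  by_cases hx0 : 0 ≤ x
  · exact h3 x hx0 hx'
  · have := h3 (-x) (by omega) (by omega)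
    rw [hw.1.1] at this
    omega

theorem ins_top {n : ℕ} {w v : Perm ℤ} (hw : InB n w) (hj : n + 1 ≤ R n w)
    (hv : ∀ x, v (sB n (n + 1) x) = w x) :
    InB (n + 1) v ∧ IsW0 n w ∧ IsW0 (n + 1) v := by
  have hdec := (le_R_iff (by omega)).1 hj
  have hw0 := isW0_of_dec hw (hdec.mono (by push_cast; omega))
  have hb1 := hv (n + 1)
  have hb2 := hv (-(n + 1))
  rw [sB_top, if_pos rfl, hw.fix _ (by omega)] at hb1
  rw [sB_top, if_neg (by omega), if_pos rfl, hw.1.1, hw.fix _ (by omega)] at hb2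
  have hb3 : ∀ x : ℤ, x ≠ n + 1 → x ≠ -((n : ℤ) + 1) → v x = w x := by
    intro x h1 h2
    have := hv x
    rw [sB_top, if_neg h1, if_neg h2] at this
    exact this
  have hv0 : IsW0 (n + 1) v := by
    intro x hx hx'
    push_cast at hx hx'
    by_cases h1 : x = n + 1
    · rw [h1, hb2]
    by_cases h2 : x = -((n : ℤ) + 1)
    · rw [h2, hb1]; omega
    rw [hb3 x h1 h2]
    exact hw0 x (by omega) (by omega)
  have hfix : ∀ i : ℤ, ((n + 1 : ℕ) : ℤ) < |i| → v i = i := by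
    intro i hi
    have hi0 := hi
    rw [lt_abs] at hi
    push_cast at hi hi0
    rw [hb3 i (by omega) (by omega)]
    exact hw.1.2 i (by omega)
  have hodd : ∀ i : ℤ, v (-i) = - v i := by
    intro i
    by_cases h : ((n + 1 : ℕ) : ℤ) < |i|
    · rw [hfix i h, hfix (-i) (by rwa [abs_neg])]
    · rw [not_lt, abs_le] at h
      rw [hv0 i h.1 h.2, hv0 (-i) (by omega) (by omega)]
  refine ⟨⟨⟨hodd, hfix⟩, ?_⟩, hw0, hv0⟩
  intro a b c d hab hbc hcd
  rw [← not_or]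
  intro ho
  have hf : ∀ i : ℤ, ((n + 1 : ℕ) : ℤ) < i → v i = i := fun i hi =>
    hfix i (lt_abs.2 (Or.inl hi))
  have h1 := occ_le hf hab hbc hcd ho
  have h2 := occ_ge hodd hf hab hbc hcd ho
  have h3 := hv0.dec a b h2 hab (by omega)
  have h4 := hv0.dec b c (by omega) hbc (by omega)
  have h5 := hv0.dec c d (by omega) hcd (by omega)
  omega

theorem del_B {n : ℕ} {v : Perm ℤ} (hv : InB (n + 1) v) (hA : InA (n + 1) v)
    (hpos : 0 < v⁻¹ ((n + 1 : ℕ) : ℤ)) :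
    ∃ w j, InB n w ∧ j ≤ n ∧ j ≤ R n w ∧ v = w * (sB n j)⁻¹ := by
  have hd1 := fix_le hv.inv.fix (i := ((n + 1 : ℕ) : ℤ)) le_rfl
  obtain ⟨j, hj⟩ := Int.eq_ofNat_of_zero_le
    (show 0 ≤ (n : ℤ) + 1 - v⁻¹ ((n + 1 : ℕ) : ℤ) by push_cast at *; omega)
  have hd : v⁻¹ ((n + 1 : ℕ) : ℤ) = n + 1 - j := by omega
  have hjn : j ≤ n := by omega
  have h1 : v ((n : ℤ) + 1 - j) = n + 1 := by
    rw [← hd]; simp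
  unfold InA at hA
  rw [hd] at hA
  push_cast at hA
  have hodd : ∀ i : ℤ, (v * sB n j) (-i) = - (v * sB n j) i := by
    intro i
    rw [Perm.mul_apply, Perm.mul_apply, sB_odd hjn, hv.1.1]
  have hfix : ∀ i : ℤ, (n : ℤ) < |i| → (v * sB n j) i = i := by
    have hp : ∀ i : ℤ, (n : ℤ) < i → (v * sB n j) i = i := by
      intro i hi
      rw [Perm.mul_apply, sB_apply hjn]
      by_cases h3 : i = n + 1
      · rw [if_pos h3, h1, h3]
      · rw [if_neg h3, if_neg (by omega), if_neg (by omega), if_neg (by omega)]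
        exact hv.fix i (by push_cast; omega)
    intro i hi
    rcases lt_abs.1 hi with h | h
    · exact hp i h
    · have := hp _ h
      rw [hodd] at this
      omega
  refine ⟨v * sB n j, j, ⟨⟨hodd, hfix⟩, ?_⟩, hjn, ?_, ?_⟩
  · refine smooth_of_embed (t := sB n j) (fun x => x ≠ (n : ℤ) + 1 ∧ x ≠ -((n : ℤ) + 1))
      (fun _ => rfl) hv.2 (sB_mono hjn) ?_
    intro a b c d hab hbc hcd ho
    have hf : ∀ i : ℤ, (n : ℤ) < i → (v * sB n j) i = i := fun i hi =>
      hfix i (lt_abs.2 (Or.inl hi))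
    have := occ_le hf hab hbc hcd ho
    have := occ_ge hodd hf hab hbc hcd ho
    refine ⟨?_, ?_, ?_, ?_⟩ <;> omega
  · rw [le_R_iff (by omega)]
    refine dec_del hA ?_
    intro x hx hx'
    rw [Perm.mul_apply, sB_apply hjn, if_neg (by omega), if_neg (by omega), if_pos ⟨hx, hx'⟩]
  · simp

theorem del_top {n : ℕ} {v : Perm ℤ} (hv : InB (n + 1) v) (hA : InA (n + 1) v)
    (hneg : v⁻¹ ((n + 1 : ℕ) : ℤ) ≤ 0) :
    ∃ w, InB n w ∧ n + 1 ≤ R n w ∧ v = w * (sB n (n + 1))⁻¹ := by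
  unfold InA at hA
  have hv0 : IsW0 (n + 1) v := isW0_of_dec hv (hA.mono hneg)
  have hodd : ∀ i : ℤ, (v * sB n (n + 1)) (-i) = - (v * sB n (n + 1)) i := by
    intro i
    have : sB n (n + 1) (-i) = - sB n (n + 1) i := by
      simp only [sB_top]
      split_ifs <;> omega
    rw [Perm.mul_apply, Perm.mul_apply, this, hv.1.1]
  have hfix : ∀ i : ℤ, (n : ℤ) < |i| → (v * sB n (n + 1)) i = i := by
    have hp : ∀ i : ℤ, (n : ℤ) < i → (v * sB n (n + 1)) i = i := by
      intro i hi
      rw [Perm.mul_apply, sB_top]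
      by_cases h3 : i = n + 1
      · rw [if_pos h3, hv0 _ (by push_cast; omega) (by push_cast; omega), h3]; omega
      · rw [if_neg h3, if_neg (by omega)]
        exact hv.fix i (by push_cast; omega)
    intro i hi
    rcases lt_abs.1 hi with h | h
    · exact hp i h
    · have := hp _ h
      rw [hodd] at this
      omega
  have hw0 : IsW0 n (v * sB n (n + 1)) := by
    intro x hx hx'
    rw [Perm.mul_apply, sB_top, if_neg (by omega), if_neg (by omega)]
    exact hv0 x (by push_cast; omega) (by push_cast; omega)
  refine ⟨v * sB n (n + 1), ⟨⟨hodd, hfix⟩, ?_⟩, hw0.R_eq.ge, by simp⟩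
  intro a b c d hab hbc hcd
  rw [← not_or]
  intro ho
  have hf : ∀ i : ℤ, (n : ℤ) < i → (v * sB n (n + 1)) i = i := fun i hi =>
    hfix i (lt_abs.2 (Or.inl hi))
  have h1 := occ_le hf hab hbc hcd ho
  have h2 := occ_ge hodd hf hab hbc hcd ho
  have h3 := hw0.dec a b h2 hab (by omega)
  have h4 := hw0.dec b c (by omega) hbc (by omega)
  have h5 := hw0.dec c d (by omega) hcd (by omega)
  omega

theorem ins_B_all {n j : ℕ} {w v : Perm ℤ} (hw : InB n w) (hj : j ≤ R n w)
    (hv : ∀ x, v (sB n j x) = w x) :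
    InB (n + 1) v ∧ InA (n + 1) v ∧ lab (n + 1) v = child (lab n w) j ∧
      v⁻¹ ((n + 1 : ℕ) : ℤ) = if j = n + 1 then -((n : ℤ) + 1) else (n : ℤ) + 1 - j := by
  by_cases hjn : j = n + 1
  · subst hjn
    have h := ins_top hw hj hv
    refine ⟨h.1, h.2.2.inA, ?_, ?_⟩
    · rw [h.2.1.lab_eq, h.2.2.lab_eq]
      simp [child]
    · rw [if_pos rfl, h.2.2.inv _ (by omega) le_rfl]
      push_cast; rfl
  · have hjn' := hj.trans (R_le n w)
    have h := ins_B hw hj (by omega) hv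
    refine ⟨h.1, h.2.2, lab_B hw hj (by omega) hv, ?_⟩
    rw [if_neg hjn, h.2.1]

open Classical in
theorem hins_B (n : ℕ) (f : Lab → ℕ) :
    ∑ w ∈ XB (n + 1) with InA (n + 1) w, f (lab (n + 1) w) =
      ∑ w ∈ XB n, ∑ j ∈ Finset.range (R n w + 1), f (child (lab n w) j) := by
  rw [Finset.sum_sigma']
  symm
  have hvs : ∀ (w : Perm ℤ) (j : ℕ), ∀ x, (w * (sB n j)⁻¹) (sB n j x) = w x := by
    intro w j x; simp
  refine Finset.sum_bij (fun p _ => p.1 * (sB n p.2)⁻¹) ?_ ?_ ?_ ?_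
  · rintro ⟨w, j⟩ h
    simp only [Finset.mem_sigma, Finset.mem_range, mem_XB, Finset.mem_filter] at h ⊢
    have := ins_B_all h.1 (by omega) (hvs w j)
    exact ⟨this.1, this.2.1⟩
  · rintro ⟨w, j⟩ h ⟨w', j'⟩ h' heq
    simp only [Finset.mem_sigma, Finset.mem_range, mem_XB] at h h' heq
    have h1 := (ins_B_all h.1 (by omega) (hvs w j)).2.2.2
    have h2 := (ins_B_all h'.1 (by omega) (hvs w' j')).2.2.2
    have h3 := R_le n w
    have h4 := R_le n w'
    rw [heq, h2] at h1
    have : j = j' := by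
      split_ifs at h1 <;> omega
    subst this
    have := mul_right_cancel heq
    rw [this]
  · intro v hv
    simp only [Finset.mem_filter, mem_XB] at hv
    rcases lt_or_ge 0 (v⁻¹ ((n + 1 : ℕ) : ℤ)) with hp | hp
    · obtain ⟨w, j, hw, _, hj, rfl⟩ := del_B hv.1 hv.2 hp
      refine ⟨⟨w, j⟩, ?_, rfl⟩
      simp only [Finset.mem_sigma, Finset.mem_range, mem_XB]
      exact ⟨hw, by omega⟩
    · obtain ⟨w, hw, hj, rfl⟩ := del_top hv.1 hv.2 hp
      refine ⟨⟨w, n + 1⟩, ?_, rfl⟩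
      simp only [Finset.mem_sigma, Finset.mem_range, mem_XB]
      exact ⟨hw, by omega⟩
  · rintro ⟨w, j⟩ h
    simp only [Finset.mem_sigma, Finset.mem_range, mem_XB] at h
    simp only
    rw [(ins_B_all h.1 (by omega) (hvs w j)).2.2.1]

theorem card_XB (n : ℕ) : (XB n).card = desc n (lab 0 1) := by
  refine count_main XB XB_zero ?_ ?_ hins_B n
  · intro n w hw
    rw [mem_XB] at *; exact hw.inv
  · intro n w hw
    rw [mem_XB] at hw
    exact dichotomy hw.fix hw.2

/-- Zero may be inserted in the middle without creating occurrences. -/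
theorem smooth_of_nonzero {w : Perm ℤ} (hodd : ∀ i, w (-i) = - w i)
    (h : ∀ a b c d : ℤ, a < b → b < c → c < d → a ≠ 0 → b ≠ 0 → c ≠ 0 → d ≠ 0 →
      ¬ ((w c < w d ∧ w d < w a ∧ w a < w b) ∨ (w d < w b ∧ w b < w c ∧ w c < w a))) :
    Smooth w := by
  have h0 : w 0 = 0 := by
    have := hodd 0
    rw [neg_zero] at this
    omega
  have half : ∀ a b c d : ℤ, a < b → b < c → c < d → (a = 0 ∨ b = 0) →
      ¬ ((w c < w d ∧ w d < w a ∧ w a < w b) ∨ (w d < w b ∧ w b < w c ∧ w c < w a)) := by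
    intro a b c d hab hbc hcd hz ho
    have ec := hodd c
    have ed := hodd d
    have key := h (-d) (-c) c d (by omega) (by omega) (by omega) (by omega) (by omega) (by omega)
      (by omega)
    rcases hz with rfl | rfl
    · have eb := hodd b
      have k1 := h (-d) (-b) c d (by omega) (by omega) (by omega) (by omega) (by omega)
        (by omega) (by omega)
      have k2 := h (-d) b c d (by omega) (by omega) (by omega) (by omega) (by omega)
        (by omega) (by omega)
      omega
    · have ea := hodd a
      rcases lt_trichotomy a (-d) with h1 | h1 | h1
      · have k1 := h a (-c) c (-a) (by omega) (by omega) (by omega) (by omega) (by omega)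
          (by omega) (by omega)
        omega
      · subst h1
        omega
      · have k1 := h (-d) a (-a) d (by omega) (by omega) (by omega) (by omega) (by omega)
          (by omega) (by omega)
        omega
  intro a b c d hab hbc hcd
  rw [← not_or]
  intro ho
  by_cases h1 : a = 0 ∨ b = 0
  · exact half a b c d hab hbc hcd h1 ho
  by_cases h2 : c = 0 ∨ d = 0
  · exact half (-d) (-c) (-b) (-a) (by omega) (by omega) (by omega) (by omega) (occ_neg hodd ho)
  exact h a b c d hab hbc hcd (by omega) (by omega) (by omega) (by omega) ho

theorem InB_iff (n : ℕ) (w : Perm ℤ) :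
    (IsBn n w ∧ LongAvoids3412 n w ∧ LongAvoids4231 n w) ↔ InB n w := by
  constructor
  · rintro ⟨hB, h1, h2⟩
    refine ⟨hB, smooth_of_nonzero hB.1 ?_⟩
    intro a b c d hab hbc hcd ha hb hc hd ho
    have hf : ∀ i : ℤ, (n : ℤ) < i → w i = i := fun i hi => hB.2 i (lt_abs.2 (Or.inl hi))
    have hle := occ_le hf hab hbc hcd ho
    have hge := occ_ge hB.1 hf hab hbc hcd ho
    rcases ho with ho | ho
    · exact h1 ⟨a, b, c, d, hge, hab, hbc, hcd, hle, ha, hb, hc, hd, ho⟩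
    · exact h2 ⟨a, b, c, d, hge, hab, hbc, hcd, hle, ha, hb, hc, hd, ho⟩
  · rintro ⟨hB, hs⟩
    refine ⟨hB, ?_, ?_⟩
    · rintro ⟨a, b, c, d, _, hab, hbc, hcd, _, _, _, _, _, ho⟩
      exact (hs a b c d hab hbc hcd).1 ho
    · rintro ⟨a, b, c, d, _, hab, hbc, hcd, _, _, _, _, _, ho⟩
      exact (hs a b c d hab hbc hcd).2 ho

/-- The index set of the window. -/
def finE (n : ℕ) : Fin (n + 1) ≃ {i : ℤ // 0 ≤ i ∧ i ≤ n} where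
  toFun k := ⟨(k : ℕ), by omega, by omega⟩
  invFun i := ⟨i.1.toNat, by have := i.2; omega⟩
  left_inv k := by ext; simp
  right_inv i := by
    have := i.2
    ext
    simp [this.1]

theorem finE_lt (n : ℕ) (a b : Fin (n + 1)) : ((finE n a : ℤ) < (finE n b : ℤ)) ↔ a < b := by
  simp [finE]

noncomputable def permE (n : ℕ) : Perm (Fin (n + 1)) ≃
    {w : Perm ℤ // ∀ i : ℤ, ¬ (0 ≤ i ∧ i ≤ (n : ℤ)) → w i = i} :=
  (Equiv.permCongr (finE n)).trans
    (Perm.subtypeEquivSubtypePerm (fun i : ℤ => 0 ≤ i ∧ i ≤ (n : ℤ)))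

theorem permE_apply (n : ℕ) (u : Perm (Fin (n + 1))) (k : Fin (n + 1)) :
    (permE n u : Perm ℤ) (finE n k : ℤ) = (finE n (u k) : ℤ) := by
  simp [permE, Perm.subtypeEquivSubtypePerm]

theorem InS_iff (n : ℕ) (u : Perm (Fin (n + 1))) :
    (FinAvoids3412 u ∧ FinAvoids4231 u) ↔ Smooth (permE n u : Perm ℤ) := by
  have hfix := (permE n u).2
  constructor
  · rintro ⟨h1, h2⟩ a b c d hab hbc hcd
    rw [← not_or]
    intro ho
    have hle := occ_le (fun i (hi : (n : ℤ) < i) => hfix i (by omega)) hab hbc hcd ho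
    have hge : 0 ≤ a := by
      by_contra hc
      have ha := hfix a (by omega)
      rcases lt_or_ge d 0 with hd | hd
      · have := hfix d (by omega)
        omega
      · have hneg : ∀ x, (permE n u : Perm ℤ) x < 0 → x < 0 := by
          intro x hx
          have := (permE n u : Perm ℤ).injective (hfix _ (show ¬ (0 ≤ (permE n u : Perm ℤ) x ∧
            (permE n u : Perm ℤ) x ≤ (n : ℤ)) by omega))
          omega
        have := hneg d (by omega)
        omega
    have hs : ∀ x : ℤ, 0 ≤ x → x ≤ n → ∃ k, (finE n k : ℤ) = x := by
      intro x hx hx'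
      obtain ⟨k, hk⟩ := (finE n).surjective ⟨x, hx, hx'⟩
      exact ⟨k, by rw [hk]⟩
    obtain ⟨a, rfl⟩ := hs a (by omega) (by omega)
    obtain ⟨b, rfl⟩ := hs b (by omega) (by omega)
    obtain ⟨c, rfl⟩ := hs c (by omega) (by omega)
    obtain ⟨d, rfl⟩ := hs d (by omega) (by omega)
    simp only [permE_apply, finE_lt] at hab hbc hcd ho
    rcases ho with ho | ho
    · exact h1 ⟨a, b, c, d, hab, hbc, hcd, ho⟩
    · exact h2 ⟨a, b, c, d, hab, hbc, hcd, ho⟩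
  · intro hs
    constructor
    · rintro ⟨a, b, c, d, hab, hbc, hcd, ho⟩
      rw [← finE_lt] at hab hbc hcd
      have := (hs _ _ _ _ hab hbc hcd).1
      simp only [permE_apply, finE_lt] at this
      exact this ho
    · rintro ⟨a, b, c, d, hab, hbc, hcd, ho⟩
      rw [← finE_lt] at hab hbc hcd
      have := (hs _ _ _ _ hab hbc hcd).2
      simp only [permE_apply, finE_lt] at this
      exact this ho

theorem card_S (n : ℕ) :
    Nat.card {u : Perm (Fin (n + 1)) // FinAvoids3412 u ∧ FinAvoids4231 u} = (XS n).card := by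
  rw [← Nat.card_eq_finsetCard]
  refine Nat.card_congr (Equiv.ofBijective
    (fun u => (⟨(permE n u.1 : Perm ℤ), mem_XS.2 ⟨fun i hi => (permE n u.1).2 i (by omega),
      (InS_iff n u.1).1 u.2⟩⟩ : {w // w ∈ XS n})) ⟨?_, ?_⟩)
  · intro u u' h
    rw [Subtype.mk.injEq] at h
    exact Subtype.ext ((permE n).injective (Subtype.ext h))
  · rintro ⟨w, hw⟩
    have hw' := mem_XS.1 hw
    obtain ⟨u, hu⟩ := (permE n).surjective ⟨w, fun i hi => hw'.1 i (by omega)⟩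
    have hu' : (permE n u : Perm ℤ) = w := by rw [hu]
    exact ⟨⟨u, (InS_iff n u).2 (by rw [hu']; exact hw'.2)⟩, Subtype.ext hu'⟩

theorem card_B (n : ℕ) :
    Nat.card {w : Perm ℤ // IsBn n w ∧ LongAvoids3412 n w ∧ LongAvoids4231 n w}
      = (XB n).card := by
  rw [← Nat.card_eq_finsetCard]
  exact Nat.card_congr (Equiv.subtypeEquivRight fun w => by rw [InB_iff, mem_XB])

end SmoothCount

/-- The number of elements of `B_n` whose long one-line notation avoids
`3412` and `4231` equals the number of permutations of `{1, …, n+1}` avoiding `3412`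
and `4231`. -/
theorem stmt_5 (n : ℕ) (hn : 1 ≤ n) :
    Nat.card {w : Equiv.Perm ℤ // IsBn n w ∧ LongAvoids3412 n w ∧ LongAvoids4231 n w}
      = Nat.card {u : Equiv.Perm (Fin (n + 1)) // FinAvoids3412 u ∧ FinAvoids4231 u} := by
  rw [SmoothCount.card_B, SmoothCount.card_S, SmoothCount.card_XB, SmoothCount.card_XS]
end
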